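/- arXiv:1105.3441 — 3 statements merged into one kernel-verified Lean document; each statement's English description precedes it below -/
import Mathlib

section
/- Let p be the unique real number in (0,1) satisfying p^3 = (1-p)^2. Then the Hausdorff dimension of X_G (with respect to the metric ρ on Σ₂) is at least -log₂ p. -/
open scoped ENNReal
open Filter MeasureTheory

/-- The space `Σ₂ = {0,1}^ℕ` of binary sequences indexed by the positive integers:
a point `x : SigmaTwo` represents the sequence `(x_k)_{k ≥ 1}` with `x_k = x (k - 1)`. -/
def SigmaTwo : Type := ℕ → Fin 2

namespace SigmaTwo

/-- Reinterpret a point of `Σ₂` as a bare sequence. -/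
def toSeq (x : SigmaTwo) : ℕ → Fin 2 := x

attribute [local instance] PiNat.dist

open Classical in
/-- The metric `ρ(x,y) = 2^{-min{n ≥ 1 : x_n ≠ y_n}}`: in the 0-indexed representation the
least positive-integer index (`≥ 1`) where `x` and `y` differ is `PiNat.firstDiff x y + 1`. -/
noncomputable def rho (x y : SigmaTwo) : ℝ :=
  if x = y then 0 else (2 : ℝ) ^ (-((PiNat.firstDiff (toSeq x) (toSeq y) : ℤ) + 1))

theorem rho_eq_dist_div_two (x y : SigmaTwo) : rho x y = dist (toSeq x) (toSeq y) / 2 := by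
  rcases eq_or_ne x y with rfl | h
  · have : dist (toSeq x) (toSeq x) = 0 := PiNat.dist_self _
    rw [rho, if_pos rfl, this]; norm_num
  · have h' : toSeq x ≠ toSeq y := h
    rw [rho, if_neg h, PiNat.dist_eq_of_ne h']
    rw [zpow_neg, zpow_add₀ (by norm_num : (2:ℝ) ≠ 0), zpow_natCast, zpow_one, mul_inv,
      one_div, inv_pow]
    ring

theorem rho_self (x : SigmaTwo) : rho x x = 0 := by
  rw [rho_eq_dist_div_two, PiNat.dist_self]; norm_num

theorem rho_comm (x y : SigmaTwo) : rho x y = rho y x := by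
  rw [rho_eq_dist_div_two, rho_eq_dist_div_two, PiNat.dist_comm]

theorem rho_triangle (x y z : SigmaTwo) : rho x z ≤ rho x y + rho y z := by
  rw [rho_eq_dist_div_two, rho_eq_dist_div_two, rho_eq_dist_div_two]
  have := PiNat.dist_triangle (toSeq x) (toSeq y) (toSeq z)
  linarith

theorem rho_eq_zero {x y : SigmaTwo} (h : rho x y = 0) : x = y := by
  rw [rho_eq_dist_div_two] at h
  exact PiNat.eq_of_dist_eq_zero (toSeq x) (toSeq y) (by linarith)

/-- `Σ₂` equipped with the metric `ρ`. -/
noncomputable instance : MetricSpace SigmaTwo where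
  dist := rho
  dist_self := rho_self
  dist_comm := rho_comm
  dist_triangle := rho_triangle
  eq_of_dist_eq_zero := rho_eq_zero

noncomputable instance : MeasurableSpace SigmaTwo := borel SigmaTwo

instance : BorelSpace SigmaTwo := ⟨rfl⟩

/-- The symbolic multiplicative golden mean shift
`X_G = {(x_k) : x_k x_{2k} = 0 for all k ≥ 1}`. -/
def XG : Set SigmaTwo :=
  {x | ∀ k : ℕ, 1 ≤ k → (x (k - 1) : ℕ) * (x (2 * k - 1) : ℕ) = 0}

/-- The (additive) golden mean shift `Σ_G = {(x_k) : x_k x_{k+1} = 0 for all k ≥ 1}`. -/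
def SigmaG : Set SigmaTwo :=
  {x | ∀ k : ℕ, 1 ≤ k → (x (k - 1) : ℕ) * (x k : ℕ) = 0}

/-- The cylinder `[x_1 … x_n]`: all sequences agreeing with `x` in coordinates `1, …, n`. -/
def cylinder (x : SigmaTwo) (n : ℕ) : Set SigmaTwo := {y | ∀ i : ℕ, i < n → y i = x i}


/-- The self-referential relation `N n ≈ q (n - N (n / 2))` forces `N` to be asymptotically
linear, so that `N (n / 2)` exceeds `N n / 2` by at most `o(n)`. -/
theorem half_sub_le_of_recursion {N : ℕ → ℝ} {q : ℝ} (hq0 : 0 < q) (hq1 : q < 1)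
    (H : ∀ δ > 0, ∃ K : ℝ, ∀ n : ℕ, |N n - q * (n - N (n / 2))| ≤ δ * n + K)
    {ε : ℝ} (hε : 0 < ε) : ∃ K : ℝ, ∀ n : ℕ, N (n / 2) - N n / 2 ≤ ε * n + K := by
  obtain ⟨K₀, hK₀⟩ := H (ε / 2) (by positivity)
  have hK₀' : 0 ≤ K₀ := by simpa using (abs_nonneg _).trans (hK₀ 0)
  obtain ⟨c, hc⟩ : ∃ c : ℝ, c = q / (1 + q / 2) := ⟨_, rfl⟩
  have hcq : q = c + q * c / 2 := by rw [hc]; field_simp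
  have hc0 : 0 < c := by rw [hc]; positivity
  have hqc : q * c ≤ 1 := by nlinarith
  have hfloor : ∀ n : ℕ, ((n / 2 : ℕ) : ℝ) ≤ n / 2 ∧ (n : ℝ) / 2 - 1 / 2 ≤ ((n / 2 : ℕ) : ℝ) := by
    intro n
    have h1 : 2 * (n / 2) ≤ n := by omega
    have h2 : n ≤ 2 * (n / 2) + 1 := by omega
    have h1' : (2 : ℝ) * ((n / 2 : ℕ) : ℝ) ≤ n := by exact_mod_cast h1
    have h2' : (n : ℝ) ≤ 2 * ((n / 2 : ℕ) : ℝ) + 1 := by exact_mod_cast h2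
    constructor <;> linarith
  obtain ⟨K, hK⟩ : ∃ K : ℝ, q * K + (K₀ + 1) = K :=
    ⟨(K₀ + 1) / (1 - q), by have : 1 - q ≠ 0 := by linarith
                            field_simp; ring⟩
  have hKpos : 0 ≤ K := by nlinarith
  have key : ∀ n : ℕ, |N n - c * n| ≤ ε * n + K := by
    intro n
    induction n using Nat.strong_induction_on with
    | _ n ih =>
      have hu := hK₀ n
      have hrem : |q * c * (n / 2 - ((n / 2 : ℕ) : ℝ))| ≤ 1 := by
        rw [abs_of_nonneg (mul_nonneg (by positivity) (by linarith [(hfloor n).1]))]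
        nlinarith [hfloor n, mul_pos hq0 hc0]
      rcases Nat.eq_zero_or_pos n with rfl | hn
      · norm_num at hu ⊢
        have e : N 0 - c * 0 = N 0 := by ring
        have e2 : N 0 + q * N 0 = (1 + q) * N 0 := by ring
        rw [e2, abs_mul, abs_of_pos (by linarith : 0 < 1 + q)] at hu
        nlinarith [abs_nonneg (N 0), mul_nonneg hq0.le hKpos]
      · have hv := ih (n / 2) (by omega)
        have e : N n - c * n = (N n - q * (n - N (n / 2)))
            - q * (N (n / 2) - c * ((n / 2 : ℕ) : ℝ))
            + q * c * (n / 2 - ((n / 2 : ℕ) : ℝ)) := by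
          linear_combination (n : ℝ) * hcq
        have hqv : |q * (N (n / 2) - c * ((n / 2 : ℕ) : ℝ))| ≤ ε * n / 2 + q * K := by
          rw [abs_mul, abs_of_pos hq0]
          have h1 : ε * ((n / 2 : ℕ) : ℝ) ≤ ε * (n / 2) :=
            mul_le_mul_of_nonneg_left (hfloor n).1 hε.le
          have h2 : q * (ε * n / 2) ≤ 1 * (ε * n / 2) :=
            mul_le_mul_of_nonneg_right hq1.le (by positivity)
          nlinarith [mul_le_mul_of_nonneg_left hv hq0.le]
        rw [e]
        refine (abs_add_le _ _).trans ?_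
        have := abs_sub (N n - q * (n - N (n / 2))) (q * (N (n / 2) - c * ((n / 2 : ℕ) : ℝ)))
        linarith
  refine ⟨2 * K, fun n => ?_⟩
  have h1 := (abs_le.1 (key n)).1
  have h2 := (abs_le.1 (key (n / 2))).2
  have h3 := mul_le_mul_of_nonneg_left (hfloor n).1 hε.le
  have h4 := mul_le_mul_of_nonneg_left (hfloor n).1 hc0.le
  linarith

/-- The map sending a sequence `ω` to the point of `X_G` obtained by processing the coordinates
in order: coordinate `2k` is forced to be `0` when coordinate `k` is `1`, and every other
coordinate is copied from `ω`. -/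
def goldenMap (ω : ℕ → Fin 2) (i : ℕ) : Fin 2 :=
  if _h : i % 2 = 1 then (if goldenMap ω (i / 2) = 1 then 0 else ω i) else ω i
termination_by i
decreasing_by omega

/-- The indicator that coordinate `i` of `goldenMap ω` is copied from `ω`. -/
noncomputable def free (ω : ℕ → Fin 2) (i : ℕ) : ℝ :=
  if i % 2 = 1 ∧ goldenMap ω (i / 2) = 1 then 0 else 1

/-- The number of ones among the first `n` coordinates of `goldenMap ω`. -/
noncomputable def ones (ω : ℕ → Fin 2) (n : ℕ) : ℝ :=
  ∑ i ∈ Finset.range n, ((goldenMap ω i : ℕ) : ℝ)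

theorem free_eq_zero_or_one (ω : ℕ → Fin 2) (i : ℕ) : free ω i = 0 ∨ free ω i = 1 := by
  unfold free; split_ifs <;> simp

theorem coe_goldenMap (ω : ℕ → Fin 2) (i : ℕ) :
    ((goldenMap ω i : ℕ) : ℝ) = free ω i * ((ω i : ℕ) : ℝ) := by
  rw [goldenMap, free]
  split_ifs <;> simp_all

theorem goldenMap_of_free {ω : ℕ → Fin 2} {i : ℕ} (h : free ω i = 1) :
    goldenMap ω i = ω i := by
  rw [free] at h
  rw [goldenMap]
  split_ifs at h ⊢ <;> simp_all

theorem goldenMap_mem_XG (ω : ℕ → Fin 2) : (goldenMap ω : SigmaTwo) ∈ XG := by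
  intro k hk
  have h1 : (2 * k - 1) % 2 = 1 := by omega
  have h2 : (2 * k - 1) / 2 = k - 1 := by omega
  rw [goldenMap.eq_1 ω (2 * k - 1), dif_pos h1, h2]
  split_ifs with h
  · simp
  · have : goldenMap ω (k - 1) = 0 := by omega
    simp [this]

theorem sum_free (ω : ℕ → Fin 2) (n : ℕ) :
    ∑ i ∈ Finset.range n, free ω i = n - ones ω (n / 2) := by
  induction n with
  | zero => simp [ones]
  | succ n ih =>
    rw [Finset.sum_range_succ, ih, free]
    rcases Nat.mod_two_eq_zero_or_one n with h | h
    · have : (n + 1) / 2 = n / 2 := by omega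
      rw [this, if_neg (by omega)]; push_cast; ring
    · have : (n + 1) / 2 = n / 2 + 1 := by omega
      rw [this, ones, ones, Finset.sum_range_succ]
      have h01 : goldenMap ω (n / 2) = 0 ∨ goldenMap ω (n / 2) = 1 := by omega
      rcases h01 with h0 | h0
      · simp [h0, h]
        ring
      · simp [h0, h]

theorem goldenMap_congr {ω ω' : ℕ → Fin 2} {i : ℕ} (h : ∀ j ≤ i, ω j = ω' j) :
    goldenMap ω i = goldenMap ω' i := by
  induction i using Nat.strong_induction_on with
  | _ i ih =>
    rw [goldenMap.eq_1 ω i, goldenMap.eq_1 ω' i, h i le_rfl]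
    by_cases h1 : i % 2 = 1
    · rw [ih (i / 2) (by omega) fun j hj => h j (hj.trans (Nat.div_le_self i 2))]
    · rw [dif_neg h1, dif_neg h1]

theorem free_congr_of_goldenMap {ω ω' : ℕ → Fin 2} {i : ℕ}
    (h : ∀ j < i, goldenMap ω j = goldenMap ω' j) : free ω i = free ω' i := by
  unfold free
  by_cases hi : i % 2 = 1
  · rw [h (i / 2) (by omega)]
  · simp [hi]

theorem free_congr {ω ω' : ℕ → Fin 2} {i : ℕ} (h : ∀ j < i, ω j = ω' j) :
    free ω i = free ω' i :=
  free_congr_of_goldenMap fun _ hj => goldenMap_congr fun k hk => h k (hk.trans_lt hj)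

/-- The law on `{0, 1}` giving mass `p` to `0` and mass `1 - p` to `1`. -/
noncomputable def coin (p : ℝ) : Measure (Fin 2) :=
  ENNReal.ofReal p • Measure.dirac 0 + ENNReal.ofReal (1 - p) • Measure.dirac 1

theorem isProbabilityMeasure_coin {p : ℝ} (hp : p ∈ Set.Ioo (0 : ℝ) 1) :
    IsProbabilityMeasure (coin p) := by
  constructor
  have h : (0 : ℝ) ≤ 1 - p := by linarith [hp.2]
  simp [coin, ← ENNReal.ofReal_add hp.1.le h]

theorem integral_coin_sub_eq_zero {p : ℝ} (hp : p ∈ Set.Ioo (0 : ℝ) 1) :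
    ∫ y, (((y : ℕ) : ℝ) - (1 - p)) ∂(coin p) = 0 := by
  have h : (0 : ℝ) ≤ 1 - p := by linarith [hp.2]
  have hprob := isProbabilityMeasure_coin hp
  rw [integral_fintype (.of_finite), Fin.sum_univ_two]
  simp [coin, measureReal_def, hp.1.le, h]
  ring

/-- The Bernoulli measure on binary sequences, with independent `coin p` coordinates. -/
noncomputable def coins (p : ℝ) : Measure (ℕ → Fin 2) :=
  Measure.infinitePi fun _ => coin p

theorem exists_eq_comp_restrict_of_congr {F : (ℕ → Fin 2) → ℝ} {n : ℕ}
    (hF : ∀ ω ω' : ℕ → Fin 2, (∀ j < n, ω j = ω' j) → F ω = F ω') :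
    ∃ G : (Finset.range n → Fin 2) → ℝ, F = fun ω => G fun i => ω i := by
  refine ⟨fun t => F fun i => if h : i ∈ Finset.range n then t ⟨i, h⟩ else 0, ?_⟩
  funext ω
  refine hF _ _ fun j hj => ?_
  simp [hj]

theorem measurable_of_congr {F : (ℕ → Fin 2) → ℝ} {n : ℕ}
    (hF : ∀ ω ω' : ℕ → Fin 2, (∀ j < n, ω j = ω' j) → F ω = F ω') : Measurable F := by
  obtain ⟨G, rfl⟩ := exists_eq_comp_restrict_of_congr hF
  have hG : Measurable G := .of_discrete
  exact hG.comp (by fun_prop)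

theorem integrable_of_congr {μ : Measure (ℕ → Fin 2)} [IsFiniteMeasure μ]
    {F : (ℕ → Fin 2) → ℝ} {n : ℕ}
    (hF : ∀ ω ω' : ℕ → Fin 2, (∀ j < n, ω j = ω' j) → F ω = F ω') : Integrable F μ := by
  have hm := measurable_of_congr hF
  obtain ⟨G, rfl⟩ := exists_eq_comp_restrict_of_congr hF
  refine Integrable.of_bound hm.aestronglyMeasurable (∑ t, ‖G t‖) (.of_forall fun ω => ?_)
  exact Finset.single_le_sum (f := fun t => ‖G t‖) (fun _ _ => norm_nonneg _) (Finset.mem_univ _)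

/-- A centred coordinate is orthogonal to every function of the earlier coordinates. -/
theorem integral_mul_sub_eq_zero {p : ℝ} (hp : p ∈ Set.Ioo (0 : ℝ) 1)
    {F : (ℕ → Fin 2) → ℝ} {n : ℕ}
    (hF : ∀ ω ω' : ℕ → Fin 2, (∀ j < n, ω j = ω' j) → F ω = F ω') :
    ∫ ω, F ω * (((ω n : ℕ) : ℝ) - (1 - p)) ∂(coins p) = 0 := by
  have hprob := isProbabilityMeasure_coin hp
  have hm := measurable_of_congr hF
  obtain ⟨G, rfl⟩ := exists_eq_comp_restrict_of_congr hF
  have hind : ProbabilityTheory.iIndepFun (fun (i : ℕ) (ω : ℕ → Fin 2) => ω i) (coins p) :=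
    ProbabilityTheory.iIndepFun_infinitePi (X := fun _ ω => ω) (by fun_prop)
  have hpair := hind.indepFun_finset (Finset.range n) {n} (by simp) (by fun_prop)
  have hG : Measurable G := .of_discrete
  have hφ : Measurable fun t : ({n} : Finset ℕ) → Fin 2 =>
    (((t ⟨n, Finset.mem_singleton_self n⟩ : ℕ) : ℝ) - (1 - p)) := .of_discrete
  have hcoord : Measurable fun ω : ℕ → Fin 2 => (((ω n : ℕ) : ℝ) - (1 - p)) :=
    (Measurable.of_discrete (f := fun y : Fin 2 => (((y : ℕ) : ℝ) - (1 - p)))).comp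
      (measurable_pi_apply n)
  have h := (hpair.comp hG hφ).integral_mul_eq_mul_integral hm.aestronglyMeasurable
    hcoord.aestronglyMeasurable
  have h0 : ∫ ω, (((ω n : ℕ) : ℝ) - (1 - p)) ∂(coins p) = 0 := by
    rw [← integral_coin_sub_eq_zero hp]
    rw [← (measurePreserving_eval_infinitePi (fun _ : ℕ => coin p) n).map_eq, integral_map
      (measurable_pi_apply n).aemeasurable (Measurable.of_discrete).aestronglyMeasurable]
    rfl
  refine h.trans ?_
  exact mul_eq_zero_of_right _ h0

/-- The multiplicative martingale attached to the increments `(ω i - (1 - p)) * free ω i`. -/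
noncomputable def expMart (p t : ℝ) (n : ℕ) (ω : ℕ → Fin 2) : ℝ :=
  ∏ i ∈ Finset.range n, (1 + t * ((((ω i : ℕ) : ℝ) - (1 - p)) * free ω i))

theorem expMart_congr (p t : ℝ) (n : ℕ) (ω ω' : ℕ → Fin 2) (h : ∀ j < n, ω j = ω' j) :
    expMart p t n ω = expMart p t n ω' := by
  refine Finset.prod_congr rfl fun i hi => ?_
  have hi' := Finset.mem_range.1 hi
  rw [h i hi', free_congr fun j hj => h j (hj.trans hi')]

theorem integral_expMart {p : ℝ} (hp : p ∈ Set.Ioo (0 : ℝ) 1) (t : ℝ) (n : ℕ) :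
    ∫ ω, expMart p t n ω ∂(coins p) = 1 := by
  have hprob := isProbabilityMeasure_coin hp
  have hprob' : IsProbabilityMeasure (coins p) := by unfold coins; infer_instance
  induction n with
  | zero => simp [expMart]
  | succ n ih =>
    have hF : ∀ ω ω' : ℕ → Fin 2, (∀ j < n, ω j = ω' j) →
        t * expMart p t n ω * free ω n = t * expMart p t n ω' * free ω' n := fun ω ω' h => by
      rw [expMart_congr p t n ω ω' h, free_congr h]
    have hsplit : ∀ ω : ℕ → Fin 2, expMart p t (n + 1) ω = expMart p t n ω
        + (t * expMart p t n ω * free ω n) * (((ω n : ℕ) : ℝ) - (1 - p)) := fun ω => by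
      rw [expMart, Finset.prod_range_succ, ← expMart]; ring
    simp_rw [hsplit]
    rw [integral_add (integrable_of_congr (expMart_congr p t n)), ih,
      integral_mul_sub_eq_zero hp hF, add_zero]
    refine integrable_of_congr (n := n + 1) fun ω ω' h => ?_
    rw [hF ω ω' fun j hj => h j (hj.trans n.lt_succ_self), h n n.lt_succ_self]

theorem exp_sub_two_mul_sq_le {x : ℝ} (hx : |x| ≤ 1 / 2) :
    Real.exp (x - 2 * x ^ 2) ≤ 1 + x := by
  obtain ⟨h1, h2⟩ := abs_le.1 hx
  have hpos : 0 < 1 + x := by linarith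
  rw [← Real.le_log_iff_exp_le hpos]
  refine le_trans ?_ (Real.one_sub_inv_le_log_of_pos hpos)
  have : 1 - (1 + x)⁻¹ = x / (1 + x) := by field_simp; ring
  rw [this, le_div_iff₀ hpos]
  nlinarith [mul_nonneg (sq_nonneg x) (by linarith : 0 ≤ 1 + 2 * x)]

theorem abs_increment_le {p : ℝ} (hp : p ∈ Set.Ioo (0 : ℝ) 1) (ω : ℕ → Fin 2) (i : ℕ) :
    |(((ω i : ℕ) : ℝ) - (1 - p)) * free ω i| ≤ 1 := by
  obtain ⟨h0, h1⟩ := hp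
  have h01 : ω i = 0 ∨ ω i = 1 := by omega
  rcases h01 with h | h <;> rcases free_eq_zero_or_one ω i with h' | h' <;>
    simp [h, h', abs_le] <;> constructor <;> linarith

theorem exp_le_expMart {p : ℝ} (hp : p ∈ Set.Ioo (0 : ℝ) 1) {t : ℝ} (ht : |t| ≤ 1 / 2)
    (n : ℕ) (ω : ℕ → Fin 2) :
    Real.exp (t * (∑ i ∈ Finset.range n, (((ω i : ℕ) : ℝ) - (1 - p)) * free ω i)
      - 2 * t ^ 2 * n) ≤ expMart p t n ω := by
  have e : t * (∑ i ∈ Finset.range n, (((ω i : ℕ) : ℝ) - (1 - p)) * free ω i) - 2 * t ^ 2 * n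
      = ∑ i ∈ Finset.range n, (t * ((((ω i : ℕ) : ℝ) - (1 - p)) * free ω i) - 2 * t ^ 2) := by
    rw [Finset.sum_sub_distrib, Finset.mul_sum]; simp; ring
  rw [e, Real.exp_sum, expMart]
  refine Finset.prod_le_prod (fun _ _ => (Real.exp_pos _).le) fun i _ => ?_
  have hd := abs_increment_le hp ω i
  set d := (((ω i : ℕ) : ℝ) - (1 - p)) * free ω i
  have hx : |t * d| ≤ 1 / 2 := by
    rw [abs_mul]; nlinarith [abs_nonneg t, abs_nonneg d]
  refine le_trans (Real.exp_le_exp.2 ?_) (exp_sub_two_mul_sq_le hx)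
  have : d ^ 2 ≤ 1 := (sq_le_one_iff_abs_le_one d).2 hd
  rw [mul_pow]
  nlinarith [sq_nonneg t]

theorem ae_exists_mul_sum_le {p : ℝ} (hp : p ∈ Set.Ioo (0 : ℝ) 1) {t : ℝ} (ht : |t| ≤ 1 / 2)
    (ht0 : t ≠ 0) :
    ∀ᵐ ω ∂(coins p), ∃ C : ℝ, ∀ n : ℕ,
      t * (∑ i ∈ Finset.range n, (((ω i : ℕ) : ℝ) - (1 - p)) * free ω i)
        ≤ 3 * t ^ 2 * n + C := by
  have hprob := isProbabilityMeasure_coin hp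
  have hprob' : IsProbabilityMeasure (coins p) := by unfold coins; infer_instance
  have ht2 : 0 < t ^ 2 := by positivity
  let f : ℕ → (ℕ → Fin 2) → ℝ := fun n ω => Real.exp (-t ^ 2) ^ n * expMart p t n ω
  have hf0 : ∀ n ω, 0 ≤ f n ω := fun n ω =>
    mul_nonneg (by positivity) ((Real.exp_pos _).le.trans (exp_le_expMart hp ht n ω))
  have hmeas : ∀ n, Measurable (f n) := fun n =>
    (measurable_of_congr (expMart_congr p t n)).const_mul _
  have hint : ∫⁻ ω, ∑' n, ENNReal.ofReal (f n ω) ∂(coins p) ≠ ⊤ := by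
    rw [lintegral_tsum fun n => (hmeas n).ennreal_ofReal.aemeasurable]
    have h1 : ∀ n, ∫⁻ ω, ENNReal.ofReal (f n ω) ∂(coins p)
        = ENNReal.ofReal (Real.exp (-t ^ 2) ^ n) := fun n => by
      rw [← ofReal_integral_eq_lintegral_ofReal
        ((integrable_of_congr (expMart_congr p t n)).const_mul _) (.of_forall (hf0 n)),
        integral_const_mul, integral_expMart hp, mul_one]
    simp_rw [h1]
    exact (summable_geometric_of_lt_one (Real.exp_pos _).le
      (Real.exp_lt_one_iff.2 (by linarith))).tsum_ofReal_ne_top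
  filter_upwards [ae_lt_top (Measurable.tsum fun n => (hmeas n).ennreal_ofReal) hint]
    with ω hω
  refine ⟨(∑' n, ENNReal.ofReal (f n ω)).toReal, fun n => ?_⟩
  have hle : f n ω ≤ (∑' n, ENNReal.ofReal (f n ω)).toReal :=
    (ENNReal.ofReal_le_iff_le_toReal hω.ne).1 (ENNReal.le_tsum n)
  have h2 : Real.exp (t * (∑ i ∈ Finset.range n, (((ω i : ℕ) : ℝ) - (1 - p)) * free ω i)
      - 3 * t ^ 2 * n) ≤ f n ω := by
    have e : t * (∑ i ∈ Finset.range n, (((ω i : ℕ) : ℝ) - (1 - p)) * free ω i)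
        - 3 * t ^ 2 * n = n * (-t ^ 2)
        + (t * (∑ i ∈ Finset.range n, (((ω i : ℕ) : ℝ) - (1 - p)) * free ω i)
          - 2 * t ^ 2 * n) := by ring
    rw [e, Real.exp_add, Real.exp_nat_mul]
    exact mul_le_mul_of_nonneg_left (exp_le_expMart hp ht n ω) (by positivity)
  have h3 := Real.add_one_le_exp
    (t * (∑ i ∈ Finset.range n, (((ω i : ℕ) : ℝ) - (1 - p)) * free ω i) - 3 * t ^ 2 * n)
  linarith

/-- The strong law of large numbers for the increments `(ω i - (1 - p)) * free ω i`. -/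
theorem ae_abs_sum_le {p : ℝ} (hp : p ∈ Set.Ioo (0 : ℝ) 1) :
    ∀ᵐ ω ∂(coins p), ∀ δ > 0, ∃ K : ℝ, ∀ n : ℕ,
      |∑ i ∈ Finset.range n, (((ω i : ℕ) : ℝ) - (1 - p)) * free ω i| ≤ δ * n + K := by
  have hpos : ∀ m : ℕ, (0 : ℝ) < 1 / ((m : ℝ) + 2) := fun m => by positivity
  have hle : ∀ m : ℕ, (1 : ℝ) / ((m : ℝ) + 2) ≤ 1 / 2 := fun m =>
    one_div_le_one_div_of_le (by norm_num) (by linarith [m.cast_nonneg (α := ℝ)])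
  have h1 := ae_all_iff.2 fun m : ℕ => ae_exists_mul_sum_le hp (t := 1 / ((m : ℝ) + 2))
    (by rw [abs_of_pos (hpos m)]; exact hle m) (hpos m).ne'
  have h2 := ae_all_iff.2 fun m : ℕ => ae_exists_mul_sum_le hp (t := -(1 / ((m : ℝ) + 2)))
    (by rw [abs_neg, abs_of_pos (hpos m)]; exact hle m) (neg_ne_zero.2 (hpos m).ne')
  filter_upwards [h1, h2] with ω h1 h2 δ hδ
  obtain ⟨m, hm⟩ := exists_nat_gt (3 / δ)
  obtain ⟨C₁, hC₁⟩ := h1 m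
  obtain ⟨C₂, hC₂⟩ := h2 m
  have ht := hpos m
  have htδ : 3 * (1 / ((m : ℝ) + 2)) ≤ δ := by
    rw [div_lt_iff₀ hδ] at hm
    rw [mul_one_div, div_le_iff₀ (by positivity)]
    nlinarith
  set t := 1 / ((m : ℝ) + 2)
  refine ⟨max C₁ C₂ / t, fun n => ?_⟩
  have a1 := hC₁ n
  have a2 := hC₂ n
  set S := ∑ i ∈ Finset.range n, (((ω i : ℕ) : ℝ) - (1 - p)) * free ω i
  have h3 : t * |S| ≤ 3 * t ^ 2 * n + max C₁ C₂ := by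
    rcases abs_cases S with ⟨h, _⟩ | ⟨h, _⟩ <;> rw [h]
    · linarith [le_max_left C₁ C₂]
    · nlinarith [le_max_right C₁ C₂]
  have h4 : t * (δ * n + max C₁ C₂ / t) = t * δ * n + max C₁ C₂ := by field_simp
  refine le_of_mul_le_mul_left ?_ ht
  rw [h4]
  nlinarith [mul_le_mul_of_nonneg_left htδ (mul_nonneg ht.le n.cast_nonneg (α := ℝ))]

theorem coin_box_eq {p : ℝ} (hp : p ∈ Set.Ioo (0 : ℝ) 1) (hpe : p ^ 3 = (1 - p) ^ 2)
    (ω : ℕ → Fin 2) (i : ℕ) :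
    coin p (if free ω i = 1 then {ω i} else Set.univ)
      = ENNReal.ofReal (Real.exp (Real.log p * (free ω i + ((goldenMap ω i : ℕ) : ℝ) / 2))) := by
  have hprob := isProbabilityMeasure_coin hp
  have hq : 0 < 1 - p := by linarith [hp.2]
  have hlog : Real.log (1 - p) = Real.log p * (3 / 2) := by
    have := congrArg Real.log hpe
    rw [Real.log_pow, Real.log_pow] at this
    push_cast at this
    linarith
  rw [coe_goldenMap]
  rcases free_eq_zero_or_one ω i with h | h
  · simp [h]
  · have h01 : ω i = 0 ∨ ω i = 1 := by omega
    rcases h01 with h' | h'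
    · simp [h, h', coin, Real.exp_log hp.1]
    · have e : Real.log p * (1 + 1 / 2) = Real.log (1 - p) := by rw [hlog]; ring
      simp only [h, h', Fin.val_one, Nat.cast_one, one_mul, if_true, e, Real.exp_log hq]
      simp [coin]

theorem coins_cylinder_le {p : ℝ} (hp : p ∈ Set.Ioo (0 : ℝ) 1) (hpe : p ^ 3 = (1 - p) ^ 2)
    (ω : ℕ → Fin 2) (n : ℕ) :
    coins p {ω' | ∀ i < n, goldenMap ω' i = goldenMap ω i}
      ≤ ENNReal.ofReal (Real.exp (Real.log p * (n - (ones ω (n / 2) - ones ω n / 2)))) := by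
  have hprob := isProbabilityMeasure_coin hp
  have hsub : {ω' | ∀ i < n, goldenMap ω' i = goldenMap ω i}
      ⊆ (Finset.range n : Set ℕ).pi fun i => if free ω i = 1 then {ω i} else Set.univ := by
    intro ω' hω' i hi
    have hi' : i < n := by simpa using hi
    have hfree : free ω' i = free ω i :=
      free_congr_of_goldenMap fun j hj => hω' j (hj.trans hi')
    change ω' i ∈ if free ω i = 1 then {ω i} else Set.univ
    split_ifs with h
    · rw [Set.mem_singleton_iff, ← goldenMap_of_free h, ← hω' i hi',
        goldenMap_of_free (hfree.trans h)]
    · trivial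
  refine (measure_mono hsub).trans ?_
  rw [coins, Measure.infinitePi_pi _ fun _ _ => .of_discrete,
    Finset.prod_congr rfl fun i _ => coin_box_eq hp hpe ω i,
    ← ENNReal.ofReal_prod_of_nonneg fun _ _ => (Real.exp_pos _).le, ← Real.exp_sum,
    ← Finset.mul_sum, Finset.sum_add_distrib, sum_free, ← Finset.sum_div, ← ones]
  exact le_of_eq (by ring_nf)

/-- Almost every cylinder of length `n` has mass at most a constant times `2 ^ (-s n)`,
for every `s < -log₂ p`. -/
theorem ae_exists_cylinder_le {p : ℝ} (hp : p ∈ Set.Ioo (0 : ℝ) 1) (hpe : p ^ 3 = (1 - p) ^ 2)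
    {s : ℝ} (hs : s < -Real.logb 2 p) :
    ∀ᵐ ω ∂(coins p), ∃ C : ℝ, ∀ n : ℕ,
      coins p {ω' | ∀ i < n, goldenMap ω' i = goldenMap ω i}
        ≤ ENNReal.ofReal (C * (2 : ℝ) ^ (-(s * n))) := by
  have hlog : Real.log p < 0 := Real.log_neg hp.1 hp.2
  have hlog2 : 0 < Real.log 2 := Real.log_pos (by norm_num)
  have hs' : s * Real.log 2 < -Real.log p := by
    rw [Real.logb, ← neg_div, lt_div_iff₀ hlog2] at hs
    exact hs
  obtain ⟨ε, hε, hεs⟩ : ∃ ε > 0, -Real.log p * ε = -Real.log p - s * Real.log 2 :=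
    ⟨(-Real.log p - s * Real.log 2) / -Real.log p, div_pos (by linarith) (by linarith),
      mul_div_cancel₀ _ (by linarith)⟩
  filter_upwards [ae_abs_sum_le hp] with ω hω
  have hrec : ∀ n : ℕ, ones ω n - (1 - p) * (n - ones ω (n / 2))
      = ∑ i ∈ Finset.range n, (((ω i : ℕ) : ℝ) - (1 - p)) * free ω i := fun n => by
    rw [← sum_free, ones, Finset.mul_sum, ← Finset.sum_sub_distrib]
    exact Finset.sum_congr rfl fun i _ => by rw [coe_goldenMap]; ring
  obtain ⟨K, hK⟩ := half_sub_le_of_recursion (N := ones ω) (q := 1 - p) (by linarith [hp.2])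
    (by linarith [hp.1]) (by simpa only [hrec] using hω) hε
  refine ⟨Real.exp (-Real.log p * K), fun n => (coins_cylinder_le hp hpe ω n).trans ?_⟩
  refine ENNReal.ofReal_le_ofReal ?_
  rw [Real.rpow_def_of_pos (by norm_num), ← Real.exp_add, Real.exp_le_exp]
  have h1 := mul_le_mul_of_nonneg_left (hK n) (by linarith : 0 ≤ -Real.log p)
  have h2 := congrArg (fun x => x * (n : ℝ)) hεs
  nlinarith

theorem dist_of_firstDiff {x y : SigmaTwo} {n : ℕ} (h : ∀ i < n, y i = x i) (hn : y n ≠ x n) :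
    dist x y = (2 : ℝ) ^ (-((n : ℝ) + 1)) := by
  have hne : x ≠ y := fun e => hn (by rw [e])
  have hne' : toSeq x ≠ toSeq y := hne
  have hfd : PiNat.firstDiff (toSeq x) (toSeq y) = n := by
    refine le_antisymm ?_ ?_
    · by_contra! hlt
      exact hn (PiNat.apply_eq_of_lt_firstDiff hlt).symm
    · by_contra! hlt
      exact PiNat.apply_firstDiff_ne hne' (h _ hlt).symm
  change rho x y = _
  rw [rho, if_neg hne, hfd, ← Real.rpow_intCast]
  push_cast
  rfl

/-- Mass distribution principle on `Σ₂` for the image of a measure `P` under a map `X`. -/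
theorem hausdorffMeasure_ne_zero_of_cylinder_le {Ω : Type*} [MeasurableSpace Ω] {P : Measure Ω}
    [NeZero P] {X : Ω → SigmaTwo} {E : Set SigmaTwo} (hX : ∀ ω, X ω ∈ E) {s : ℝ} (hs : 0 < s)
    (h : ∀ᵐ ω ∂P, ∃ C : ℝ, ∀ n : ℕ,
      P {ω' | ∀ i < n, X ω' i = X ω i} ≤ ENNReal.ofReal (C * (2 : ℝ) ^ (-(s * n)))) :
    Measure.hausdorffMeasure s E ≠ 0 := by
  let G : ℕ → Set Ω := fun N => {ω | ∀ n : ℕ,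
    P {ω' | ∀ i < n, X ω' i = X ω i} ≤ ENNReal.ofReal ((N + 1) * (2 : ℝ) ^ (-(s * n)))}
  have hG : P (⋃ N, G N) ≠ 0 := by
    have hae : (⋃ N, G N) =ᵐ[P] Set.univ := by
      rw [eventuallyEq_univ]
      filter_upwards [h] with ω ⟨C, hC⟩
      obtain ⟨N, hN⟩ := exists_nat_ge C
      refine Set.mem_iUnion.2 ⟨N, fun n => (hC n).trans (ENNReal.ofReal_le_ofReal ?_)⟩
      gcongr
      linarith
    rw [measure_congr hae]
    exact NeZero.ne _
  obtain ⟨N, hN⟩ := exists_measure_pos_of_not_measure_iUnion_null hG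
  have hscale : (0 : ℝ) < (N + 1) * 2 ^ s := by positivity
  let m : OuterMeasure SigmaTwo :=
    OuterMeasure.map X (OuterMeasure.restrict (G N) P.toOuterMeasure)
  have hm : ∀ A, m A = P (X ⁻¹' A ∩ G N) := fun A => by
    simp [m]
  have hbound : ∀ A : Set SigmaTwo,
      m A ≤ ENNReal.ofReal ((N + 1) * 2 ^ s) * Metric.ediam A ^ s := by
    intro A
    rw [hm]
    rcases Set.eq_empty_or_nonempty (X ⁻¹' A ∩ G N) with he | ⟨ω, hωA, hωG⟩
    · simp [he]
    by_cases hall : ∀ y ∈ A, ∀ i, y i = X ω i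
    · have hle : ∀ n : ℕ, P (X ⁻¹' A ∩ G N)
          ≤ ENNReal.ofReal ((N + 1) * ((2 : ℝ) ^ (-s)) ^ n) := fun n => by
        rw [← Real.rpow_mul_natCast (by norm_num), neg_mul]
        have hsub : X ⁻¹' A ∩ G N ⊆ {ω' | ∀ i < n, X ω' i = X ω i} :=
          fun ω' hω' i _ => hall _ hω'.1 i
        exact (measure_mono hsub).trans (hωG n)
      have hlim : Tendsto (fun n : ℕ => ENNReal.ofReal ((N + 1) * ((2 : ℝ) ^ (-s)) ^ n)) atTop
          (nhds (ENNReal.ofReal ((N + 1) * 0))) :=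
        ENNReal.tendsto_ofReal ((tendsto_pow_atTop_nhds_zero_of_lt_one (by positivity)
          (Real.rpow_lt_one_of_one_lt_of_neg (by norm_num) (by linarith))).const_mul _)
      have h0 := ge_of_tendsto' hlim hle
      rw [mul_zero, ENNReal.ofReal_zero] at h0
      exact h0.trans zero_le
    · push Not at hall
      have hex : ∃ i, ∃ y ∈ A, y i ≠ X ω i := by
        obtain ⟨y, hy, i, hi⟩ := hall
        exact ⟨i, y, hy, hi⟩
      classical
      obtain ⟨y, hyA, hy⟩ := Nat.find_spec hex
      have hmin : ∀ z ∈ A, ∀ i < Nat.find hex, z i = X ω i := fun z hz i hi => by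
        by_contra hne
        exact Nat.find_min hex hi ⟨z, hz, hne⟩
      set n := Nat.find hex
      have hdist := dist_of_firstDiff (hmin y hyA) hy
      have hdiam : ENNReal.ofReal ((2 : ℝ) ^ (-((n : ℝ) + 1))) ≤ Metric.ediam A := by
        rw [← hdist, ← edist_dist]
        exact Metric.edist_le_ediam_of_mem hωA hyA
      calc P (X ⁻¹' A ∩ G N)
          ≤ P {ω' | ∀ i < n, X ω' i = X ω i} := measure_mono fun ω' hω' => hmin _ hω'.1
        _ ≤ ENNReal.ofReal ((N + 1) * (2 : ℝ) ^ (-(s * n))) := hωG n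
        _ = ENNReal.ofReal ((N + 1) * 2 ^ s)
            * ENNReal.ofReal ((2 : ℝ) ^ (-((n : ℝ) + 1))) ^ s := by
          rw [ENNReal.ofReal_rpow_of_pos (by positivity), ← ENNReal.ofReal_mul hscale.le,
            ← Real.rpow_mul (by norm_num), mul_assoc, ← Real.rpow_add (by norm_num)]
          congr 3
          ring
        _ ≤ _ := by gcongr
  have hle : (ENNReal.ofReal ((N + 1) * 2 ^ s))⁻¹ • m
      ≤ (Measure.hausdorffMeasure s : Measure SigmaTwo).toOuterMeasure := by
    rw [Measure.hausdorffMeasure, Measure.mkMetric_toOuterMeasure]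
    refine OuterMeasure.le_mkMetric _ _ 1 one_pos fun A _ => ?_
    rw [smul_apply, smul_eq_mul, ENNReal.inv_mul_le_iff (by simpa using hscale)
      ENNReal.ofReal_ne_top]
    exact hbound A
  have hE : m E ≠ 0 := by
    have : X ⁻¹' E = Set.univ := Set.eq_univ_of_forall hX
    rw [hm, this, Set.univ_inter]
    exact hN.ne'
  refine (lt_of_lt_of_le ?_ (hle E)).ne'
  rw [smul_apply, smul_eq_mul]
  exact ENNReal.mul_pos (ENNReal.inv_ne_zero.2 ENNReal.ofReal_ne_top) hE

/-- Lower bound: `dim_H X_G ≥ -log₂ p` where `p ∈ (0,1)` satisfies `p³ = (1-p)²`. -/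
theorem dimH_XG_ge (p : ℝ) (hp : p ∈ Set.Ioo (0 : ℝ) 1) (hpe : p ^ 3 = (1 - p) ^ 2) :
    ENNReal.ofReal (-Real.logb 2 p) ≤ dimH XG := by
  have hprob := isProbabilityMeasure_coin hp
  have hprob' : IsProbabilityMeasure (coins p) := by unfold coins; infer_instance
  refine ENNReal.le_of_forall_nnreal_lt fun s hs => ?_
  rcases eq_or_ne s 0 with rfl | hs0
  · simp
  have hs' : (s : ℝ) < -Real.logb 2 p := by
    rwa [← ENNReal.ofReal_coe_nnreal, ENNReal.ofReal_lt_ofReal_iff_of_nonneg s.coe_nonneg] at hs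
  exact le_dimH_of_hausdorffMeasure_ne_zero (hausdorffMeasure_ne_zero_of_cylinder_le
    goldenMap_mem_XG (by positivity) (ae_exists_cylinder_le hp hpe hs'))

end SigmaTwo
end

section
/- Let m ≥ 2 and let A be a primitive m×m matrix with entries in {0,1} (i.e., some power of A has all entries positive). Then there exists a unique vector (t_0, …, t_{m-1}) of real numbers satisfying t_i > 1 and t_i^2 = Σ_{j=0}^{m-1} A(i,j) t_j for all i = 0, …, m-1. -/
open Finset in
/-- A map `t ↦ √(A t)`, written in logarithmic coordinates, is a contraction with constant `1/2`. -/
theorem contractingWith_half_log_sum_exp {ι : Type*} [Fintype ι] (A : Matrix ι ι ℝ)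
    (hA : ∀ i j, 0 ≤ A i j) (hrow : ∀ i, ∃ j, 0 < A i j) :
    ContractingWith (1 / 2)
      (fun (u : ι → ℝ) i => (1 / 2 : ℝ) * Real.log (∑ j, A i j * Real.exp (u j))) := by
  have hpos (u : ι → ℝ) (i : ι) : 0 < ∑ j, A i j * Real.exp (u j) := by
    obtain ⟨j, hj⟩ := hrow i
    exact sum_pos' (fun k _ => mul_nonneg (hA i k) (Real.exp_pos _).le)
      ⟨j, mem_univ j, mul_pos hj (Real.exp_pos _)⟩
  have hle (u v : ι → ℝ) (i : ι) :
      Real.log (∑ j, A i j * Real.exp (u j)) ≤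
        Real.log (∑ j, A i j * Real.exp (v j)) + dist u v := by
    rw [← Real.log_exp (dist u v), ← Real.log_mul (hpos v i).ne' (Real.exp_ne_zero _)]
    refine Real.log_le_log (hpos u i) ?_
    rw [sum_mul]
    refine sum_le_sum fun j _ => ?_
    rw [mul_assoc, ← Real.exp_add]
    refine mul_le_mul_of_nonneg_left (Real.exp_le_exp.2 ?_) (hA i j)
    have h := (le_abs_self _).trans ((Real.dist_eq _ _).symm.le.trans (dist_le_pi_dist u v j))
    linarith
  refine ⟨by rw [← NNReal.coe_lt_coe]; norm_num, LipschitzWith.of_dist_le_mul fun u v => ?_⟩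
  rw [dist_pi_le_iff (by positivity)]
  intro i
  have h₁ := hle u v i
  have h₂ := hle v u i
  rw [dist_comm v u] at h₂
  rw [Real.dist_eq, abs_le]
  push_cast
  constructor <;> linarith

/-- The equation `t² = A t` has exactly one positive solution when `A` is nonnegative without zero
rows. -/
theorem existsUnique_pos_sq_eq_sum {ι : Type*} [Fintype ι] (A : Matrix ι ι ℝ)
    (hA : ∀ i j, 0 ≤ A i j) (hrow : ∀ i, ∃ j, 0 < A i j) :
    ∃! t : ι → ℝ, (∀ i, 0 < t i) ∧ ∀ i, t i ^ 2 = ∑ j, A i j * t j := by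
  have hc := contractingWith_half_log_sum_exp A hA hrow
  have hfix := hc.fixedPoint_isFixedPt
  set u := hc.fixedPoint
  refine ⟨fun i => Real.exp (u i), ⟨fun i => Real.exp_pos _, fun i => ?_⟩, ?_⟩
  · have hpos : 0 < ∑ j, A i j * Real.exp (u j) := by
      obtain ⟨j, hj⟩ := hrow i
      exact Finset.sum_pos' (fun k _ => mul_nonneg (hA i k) (Real.exp_pos _).le)
        ⟨j, Finset.mem_univ j, mul_pos hj (Real.exp_pos _)⟩
    have h : (1 / 2 : ℝ) * Real.log (∑ j, A i j * Real.exp (u j)) = u i := congrFun hfix i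
    change Real.exp (u i) ^ 2 = _
    rw [← Real.exp_nat_mul, ← h, Nat.cast_ofNat, ← mul_assoc]
    norm_num [Real.exp_log hpos]
  · rintro t ⟨ht, hsq⟩
    have h : (fun i => Real.log (t i)) = u := by
      refine hc.fixedPoint_unique (funext fun i => ?_)
      simp only [Real.exp_log (ht _), ← hsq, Real.log_pow]
      push_cast
      ring
    funext i
    simp [← h, Real.exp_log (ht i)]

theorem one_le_of_sq_eq_sum {ι : Type*} [Fintype ι] {A : Matrix ι ι ℝ}
    (hA : ∀ i j, 0 ≤ A i j) (hrow : ∀ i, ∃ j, 1 ≤ A i j) {t : ι → ℝ} (ht : ∀ i, 0 < t i)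
    (hsq : ∀ i, t i ^ 2 = ∑ j, A i j * t j) (i : ι) : 1 ≤ t i := by
  have : Nonempty ι := ⟨i⟩
  obtain ⟨k, hk⟩ := Finite.exists_min t
  refine le_trans ?_ (hk i)
  obtain ⟨j, hj⟩ := hrow k
  have h : A k j * t j ≤ t k ^ 2 := by
    rw [hsq]
    exact Finset.single_le_sum (f := fun j => A k j * t j)
      (fun l _ => mul_nonneg (hA k l) (ht l).le) (Finset.mem_univ j)
  nlinarith [hk j, ht k, ht j]

/-- Indices where a solution `t ≥ 1` of `t² = A t` equals `1` are closed under successors, so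
iterating `A` keeps the value `1` there. -/
theorem sum_pow_mul_eq_one {ι : Type*} [Fintype ι] [DecidableEq ι] {A : Matrix ι ι ℝ}
    (hA01 : ∀ i j, A i j = 0 ∨ A i j = 1) {t : ι → ℝ} (ht : ∀ i, 1 ≤ t i)
    (hsq : ∀ i, t i ^ 2 = ∑ j, A i j * t j) (n : ℕ) (i : ι) (hi : t i = 1) :
    ∑ j, (A ^ n) i j * t j = 1 := by
  change (A ^ n).mulVec t i = 1
  induction n generalizing i with
  | zero => simpa using hi
  | succ n ih =>
    have hrow : ∑ j, A i j * t j = 1 := by rw [← hsq, hi, one_pow]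
    rw [pow_succ', ← Matrix.mulVec_mulVec, ← hrow]
    refine Finset.sum_congr rfl fun j _ => ?_
    rcases hA01 i j with h | h
    · simp [h]
    · have hle : A i j * t j ≤ 1 := by
        rw [← hrow]
        refine Finset.single_le_sum (f := fun j => A i j * t j) (fun l _ => ?_) (Finset.mem_univ j)
        have := ht l
        rcases hA01 i l with h | h <;> simp only [h] <;> linarith
      have htj : t j = 1 := le_antisymm (by simpa [h] using hle) (ht j)
      rw [ih j htj, htj]

theorem one_le_pow_apply_of_pos {ι : Type*} [Fintype ι] [DecidableEq ι] {A : Matrix ι ι ℝ}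
    (hA01 : ∀ i j, A i j = 0 ∨ A i j = 1) {n : ℕ} {i j : ι} (h : 0 < (A ^ n) i j) :
    1 ≤ (A ^ n) i j := by
  have hnat : ∀ i j, ∃ k : ℕ, (k : ℝ) = A i j := fun i j => by
    rcases hA01 i j with h | h
    · exact ⟨0, by simp [h]⟩
    · exact ⟨1, by simp [h]⟩
  choose B hB using hnat
  have hmap : A = (Matrix.of B).map (Nat.castRingHom ℝ) := by
    ext i j
    simp [hB]
  rw [hmap, ← Matrix.map_pow] at h ⊢
  simp only [Matrix.map_apply, Nat.coe_castRingHom] at h ⊢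
  exact_mod_cast h

/-- For a primitive 0-1 matrix `A`, there is a unique vector `(t_i)` with `t_i > 1` and
`t_i² = ∑_j A(i,j) t_j` for all `i`. -/
theorem existsUnique_perron_vector (m : ℕ) (hm : 2 ≤ m) (A : Matrix (Fin m) (Fin m) ℝ)
    (hA01 : ∀ i j, A i j = 0 ∨ A i j = 1)
    (hprim : ∃ N : ℕ, 1 ≤ N ∧ ∀ i j, 0 < (A ^ N) i j) :
    ∃! t : Fin m → ℝ, (∀ i, 1 < t i) ∧ ∀ i, t i ^ 2 = ∑ j, A i j * t j := by
  obtain ⟨N, hN, hpos⟩ := hprim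
  have hA : ∀ i j, 0 ≤ A i j := fun i j => by rcases hA01 i j with h | h <;> simp [h]
  have hrow : ∀ i, ∃ j, A i j = 1 := by
    intro i
    by_contra! h
    have hzero : ∀ j, A i j = 0 := fun j => (hA01 i j).resolve_right (h j)
    have hii := hpos i i
    obtain ⟨k, rfl⟩ := Nat.exists_eq_add_of_le' hN
    simp [pow_succ', Matrix.mul_apply, hzero] at hii
  obtain ⟨t, ⟨ht, hsq⟩, huniq⟩ := existsUnique_pos_sq_eq_sum A hA fun i =>
    (hrow i).imp fun j (hj : A i j = 1) => one_pos.trans_eq hj.symm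
  have hone := one_le_of_sq_eq_sum hA (fun i => (hrow i).imp fun j hj => hj.ge) ht hsq
  refine ⟨t, ⟨fun i => (hone i).lt_of_ne fun hi => ?_, hsq⟩, fun s hs =>
    huniq s ⟨fun i => one_pos.trans (hs.1 i), hs.2⟩⟩
  have hsum := sum_pow_mul_eq_one hA01 hone hsq N i hi.symm
  have hcard : (m : ℝ) ≤ ∑ j, (A ^ N) i j * t j := by
    calc (m : ℝ) = ∑ _j : Fin m, (1 : ℝ) := by simp
      _ ≤ _ := Finset.sum_le_sum fun j _ =>
        one_le_mul_of_one_le_of_one_le (one_le_pow_apply_of_pos hA01 (hpos i j)) (hone j)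
  have hm' : (2 : ℝ) ≤ m := by exact_mod_cast hm
  linarith
end

section
/- Let m ≥ 2 and let A be a primitive m×m matrix with entries in {0,1}. Let Ξ_A = { x = Σ_{k≥1} x_k m^{-k} : x_k ∈ {0,…,m-1}, A(x_k, x_{2k}) = 1 for all k ≥ 1 } ⊆ [0,1]. Then the Hausdorff dimension of Ξ_A equals (1/2) log_m (Σ_{i=0}^{m-1} t_i), where (t_i)_{i=0}^{m-1} is the unique vector satisfying t_i > 1 and t_i^2 = Σ_{j=0}^{m-1} A(i,j) t_j for all i. -/
open scoped ENNReal

/-- The multiplicative subshift `Ξ_A`: reals in `[0,1]` admitting a base-`m` expansion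
`x = ∑_{k ≥ 1} x_k m^{-k}` with digits `x_k ∈ {0, …, m-1}` satisfying `A(x_k, x_{2k}) = 1`
for all `k ≥ 1` (here `a j` represents the digit `x_{j+1}`). -/
def XiA (m : ℕ) (A : Matrix (Fin m) (Fin m) ℝ) : Set ℝ :=
  {x | ∃ a : ℕ → Fin m, (∀ k : ℕ, A (a k) (a (2 * k + 1)) = 1) ∧
    x = ∑' k : ℕ, ((a k : ℕ) : ℝ) / m ^ (k + 1)}

open MeasureTheory Filter Topology Finset

/-- The row of the transition table governing the `k`-th digit: the initial law when `k` is even,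
the law of the successor of the digit `k / 2` when `k` is odd. -/
def parentRow {m : ℕ} (a : ℕ → Fin m) (k : ℕ) : Option (Fin m) :=
  if Even k then none else some (a (k / 2))

/-- The product of the transition probabilities of the first `n` digits of `a`. -/
noncomputable def cylWeight {m : ℕ} (p : Option (Fin m) → Fin m → ℝ) (a : ℕ → Fin m) (n : ℕ) : ℝ :=
  ∏ k ∈ range n, p (parentRow a k) (a k)

/-- The digit sequence driven by a table `ω` of successors. -/
def chain {m : ℕ} (ω : ℕ × Option (Fin m) → Fin m) (k : ℕ) : Fin m :=
  if h : Even k then ω (k, none) else ω (k, some (chain ω (k / 2)))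
termination_by k
decreasing_by
  rcases k with _ | k
  · simp at h
  · omega

theorem chain_eq {m : ℕ} (ω : ℕ × Option (Fin m) → Fin m) (k : ℕ) :
    chain ω k = ω (k, parentRow (chain ω) k) := by
  rw [chain, parentRow]
  split_ifs <;> rfl

theorem half_lt_of_not_even {k : ℕ} (h : ¬ Even k) : k / 2 < k := by
  rcases k with _ | k
  · simp at h
  · omega

theorem parentRow_congr {m : ℕ} {a b : ℕ → Fin m} {k : ℕ} (h : ∀ i < k, a i = b i) :
    parentRow a k = parentRow b k := by
  unfold parentRow
  split_ifs with hk
  · rfl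
  · rw [h _ (half_lt_of_not_even hk)]

theorem measurable_chain {m : ℕ} :
    Measurable (chain : (ℕ × Option (Fin m) → Fin m) → ℕ → Fin m) := by
  refine measurable_pi_lambda _ fun k => ?_
  induction k using Nat.strong_induction_on with
  | _ k ih =>
    by_cases hk : Even k
    · have : (fun ω : ℕ × Option (Fin m) → Fin m => chain ω k) = fun ω => ω (k, none) := by
        ext1 ω; rw [chain_eq, parentRow, if_pos hk]
      rw [this]
      exact measurable_pi_apply _
    · have : (fun ω : ℕ × Option (Fin m) → Fin m => chain ω k) =
          (fun q : Fin m × (ℕ × Option (Fin m) → Fin m) => q.2 (k, some q.1)) ∘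
            fun ω => (chain ω (k / 2), ω) := by
        ext1 ω; simp [chain_eq ω k, parentRow, if_neg hk]
      rw [this]
      refine Measurable.comp (measurable_from_prod_countable_right fun i => ?_)
        ((ih _ (half_lt_of_not_even hk)).prodMk measurable_id)
      exact measurable_pi_apply (k, some i)

theorem chain_mem_cylinder_iff {m : ℕ} (ω : ℕ × Option (Fin m) → Fin m) (a : ℕ → Fin m) (n : ℕ) :
    chain ω ∈ PiNat.cylinder a n ↔ ∀ k < n, ω (k, parentRow a k) = a k := by
  rw [PiNat.mem_cylinder_iff]
  constructor
  · intro h k hk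
    rw [← h k hk, chain_eq, parentRow_congr fun i hi => h i (hi.trans hk)]
  · intro h k
    induction k using Nat.strong_induction_on with
    | _ k ih =>
      intro hk
      rw [chain_eq, parentRow_congr fun i hi => ih i hi (hi.trans hk), h k hk]

theorem exists_measure_cylinder_eq_cylWeight {m : ℕ} (p : Option (Fin m) → Fin m → ℝ)
    (hp0 : ∀ i j, 0 ≤ p i j) (hp1 : ∀ i, ∑ j, p i j = 1) :
    ∃ P : Measure (ℕ → Fin m), IsProbabilityMeasure P ∧
      ∀ a n, P (PiNat.cylinder a n) = ENNReal.ofReal (cylWeight p a n) := by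
  let ρ : ℕ × Option (Fin m) → Measure (Fin m) := fun q =>
    ∑ j, ENNReal.ofReal (p q.2 j) • Measure.dirac j
  have hρ : ∀ q, IsProbabilityMeasure (ρ q) := fun q => ⟨by
    simp [ρ, ← ENNReal.ofReal_sum_of_nonneg fun j _ => hp0 q.2 j, hp1]⟩
  have hρ' : ∀ q j, ρ q {j} = ENNReal.ofReal (p q.2 j) := fun q j => by
    simp [ρ, Set.indicator_apply]
  refine ⟨(Measure.infinitePi ρ).map chain,
    Measure.isProbabilityMeasure_map measurable_chain.aemeasurable, fun a n => ?_⟩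
  rw [Measure.map_apply measurable_chain (PiNat.isOpen_cylinder _ a n).measurableSet]
  let s : Finset (ℕ × Option (Fin m)) := (range n).map
    ⟨fun k => (k, parentRow a k), fun k l h => (Prod.mk.inj h).1⟩
  have hset : chain ⁻¹' PiNat.cylinder a n =
      Set.pi (s : Set (ℕ × Option (Fin m))) fun q => {a q.1} := by
    ext ω
    rw [Set.mem_preimage, chain_mem_cylinder_iff]
    simp [s, Set.mem_pi]
    rfl
  rw [hset, Measure.infinitePi_pi _ fun q _ => measurableSet_singleton _, cylWeight,
    ENNReal.ofReal_prod_of_nonneg fun k _ => hp0 _ _]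
  simp only [s, prod_map, hρ']
  rfl

theorem integral_sq_sum_le_of_orthogonal {Ω : Type*} [MeasurableSpace Ω] (P : Measure Ω)
    [IsProbabilityMeasure P] (Y : ℕ → Ω → ℝ) (hY : ∀ k, Measurable (Y k))
    (hb : ∀ k ω, |Y k ω| ≤ 1) (ho : ∀ k l, k < l → ∫ ω, Y k ω * Y l ω ∂P = 0) (n : ℕ) :
    ∫ ω, (∑ k ∈ range n, Y k ω) ^ 2 ∂P ≤ n := by
  have hint : ∀ k l, Integrable (fun ω => Y k ω * Y l ω) P := fun k l =>
    Integrable.of_bound ((hY k).mul (hY l)).aestronglyMeasurable 1 (ae_of_all _ fun ω => by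
      rw [Real.norm_eq_abs, abs_mul]
      exact mul_le_one₀ (hb k ω) (abs_nonneg _) (hb l ω))
  have hsq : ∀ n, Integrable (fun ω => (∑ k ∈ range n, Y k ω) ^ 2) P := fun n => by
    simp_rw [sq, sum_mul_sum]
    exact integrable_finsetSum _ fun k _ => integrable_finsetSum _ fun l _ => hint k l
  induction n with
  | zero => simp
  | succ n ih =>
    have hexp : ∀ ω, (∑ k ∈ range (n + 1), Y k ω) ^ 2 =
        (∑ k ∈ range n, Y k ω) ^ 2 + (2 * ∑ k ∈ range n, Y k ω * Y n ω + Y n ω * Y n ω) := by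
      intro ω; rw [sum_range_succ, ← sum_mul]; ring
    have hcross : Integrable (fun ω => ∑ k ∈ range n, Y k ω * Y n ω) P :=
      integrable_finsetSum _ fun k _ => hint k n
    have hinc : Integrable (fun ω => 2 * ∑ k ∈ range n, Y k ω * Y n ω + Y n ω * Y n ω) P :=
      (hcross.const_mul 2).add (hint n n)
    simp_rw [hexp]
    rw [integral_add (hsq n) hinc,
      integral_add (hcross.const_mul 2) (hint n n), integral_const_mul,
      integral_finsetSum _ fun k _ => hint k n,
      sum_eq_zero fun k hk => ho k n (mem_range.1 hk)]
    have hlast : ∫ ω, Y n ω * Y n ω ∂P ≤ 1 := by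
      calc ∫ ω, Y n ω * Y n ω ∂P ≤ ∫ _, (1 : ℝ) ∂P :=
            integral_mono (hint n n) (integrable_const _) fun ω => by
              have := abs_le.1 (hb n ω)
              show Y n ω * Y n ω ≤ 1
              nlinarith
        _ = 1 := by simp
    push_cast
    linarith

theorem tendsto_average_of_tendsto_average_sq {y : ℕ → ℝ} (hy : ∀ k, |y k| ≤ 1)
    (h : Tendsto (fun j : ℕ => (∑ k ∈ range (j ^ 2), y k) / (j : ℝ) ^ 2) atTop (𝓝 0)) :
    Tendsto (fun n : ℕ => (∑ k ∈ range n, y k) / n) atTop (𝓝 0) := by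
  have hsqrt : Tendsto Nat.sqrt atTop atTop :=
    tendsto_atTop_atTop.2 fun b => ⟨b * b, fun n hn => Nat.le_sqrt.2 hn⟩
  have h1 := (h.comp hsqrt).abs
  have h2 : Tendsto (fun n : ℕ => 2 / ((Nat.sqrt n : ℕ) : ℝ)) atTop (𝓝 0) :=
    tendsto_const_nhds.div_atTop (tendsto_natCast_atTop_atTop.comp hsqrt)
  have h3 := h1.add h2
  rw [abs_zero, add_zero] at h3
  refine squeeze_zero_norm' ?_ h3
  filter_upwards [eventually_ge_atTop 1] with n hn
  simp only [Function.comp]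
  set j := Nat.sqrt n with hj
  have hj1 : 1 ≤ j := Nat.le_sqrt.2 (by simpa using hn)
  have hjn : j ^ 2 ≤ n := by simpa [sq] using Nat.sqrt_le n
  have hnj : n ≤ j * j + j + j := Nat.sqrt_le_add n
  have hj0 : (0 : ℝ) < j := by exact_mod_cast hj1
  have hn0 : (0 : ℝ) < n := by exact_mod_cast hn
  have hjn' : (j : ℝ) ^ 2 ≤ n := by exact_mod_cast hjn
  have hdiff : |∑ k ∈ range n, y k| ≤ |∑ k ∈ range (j ^ 2), y k| + 2 * j := by
    rw [← sum_range_add_sum_Ico _ hjn]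
    refine (abs_add_le _ _).trans (add_le_add_right ?_ _)
    refine (abs_sum_le_sum_abs _ _).trans ((sum_le_sum fun k _ => hy k).trans ?_)
    simp only [sum_const, Nat.card_Ico, nsmul_eq_mul, mul_one]
    have : n - j ^ 2 ≤ 2 * j := by rw [sq]; omega
    exact_mod_cast this
  rw [Real.norm_eq_abs, abs_div, abs_of_pos hn0, abs_div, abs_of_pos (pow_pos hj0 2)]
  calc |∑ k ∈ range n, y k| / n ≤ (|∑ k ∈ range (j ^ 2), y k| + 2 * j) / (j : ℝ) ^ 2 := by
        gcongr
    _ = _ := by field_simp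

theorem ae_tendsto_average_of_orthogonal {Ω : Type*} [MeasurableSpace Ω] (P : Measure Ω)
    [IsProbabilityMeasure P] (Y : ℕ → Ω → ℝ) (hY : ∀ k, Measurable (Y k))
    (hb : ∀ k ω, |Y k ω| ≤ 1) (ho : ∀ k l, k < l → ∫ ω, Y k ω * Y l ω ∂P = 0) :
    ∀ᵐ ω ∂P, Tendsto (fun n : ℕ => (∑ k ∈ range n, Y k ω) / n) atTop (𝓝 0) := by
  let F : ℕ → Ω → ℝ := fun j ω => ((∑ k ∈ range (j ^ 2), Y k ω) / (j : ℝ) ^ 2) ^ 2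
  have hsum : ∀ n, Measurable fun ω => ∑ k ∈ range n, Y k ω := fun n =>
    Finset.measurable_fun_sum _ fun k _ => hY k
  have hF : ∀ j, Measurable (F j) := fun j => ((hsum _).div_const _).pow_const _
  have hFb : ∀ j, ∫⁻ ω, ENNReal.ofReal (F j ω) ∂P ≤ ENNReal.ofReal (1 / (j : ℝ) ^ 2) := by
    intro j
    have hbound : ∀ ω, |∑ k ∈ range (j ^ 2), Y k ω| ≤ (j : ℝ) ^ 2 := fun ω =>
      (abs_sum_le_sum_abs _ _).trans ((sum_le_sum fun k _ => hb k ω).trans (by simp))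
    have hFint : Integrable (F j) P := by
      refine Integrable.of_bound (hF j).aestronglyMeasurable 1 (ae_of_all _ fun ω => ?_)
      have h1 : |(∑ k ∈ range (j ^ 2), Y k ω) / (j : ℝ) ^ 2| ≤ 1 := by
        rw [abs_div, abs_of_nonneg (by positivity : (0 : ℝ) ≤ (j : ℝ) ^ 2)]
        exact div_le_one_of_le₀ (hbound ω) (by positivity)
      rw [Real.norm_eq_abs, abs_pow]
      exact pow_le_one₀ (abs_nonneg _) h1
    rw [← ofReal_integral_eq_lintegral_ofReal hFint (ae_of_all _ fun ω => sq_nonneg _)]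
    refine ENNReal.ofReal_le_ofReal ?_
    simp only [F, div_pow]
    rw [integral_div]
    have := integral_sq_sum_le_of_orthogonal P Y hY hb ho (j ^ 2)
    push_cast at this
    rcases Nat.eq_zero_or_pos j with rfl | hj
    · simp
    · have hj0 : (0 : ℝ) < j := by exact_mod_cast hj
      calc _ ≤ (j : ℝ) ^ 2 / ((j : ℝ) ^ 2) ^ 2 := by gcongr
        _ = _ := by field_simp
  have hfin : ∫⁻ ω, ∑' j, ENNReal.ofReal (F j ω) ∂P ≠ ∞ := by
    rw [lintegral_tsum fun j => (hF j).ennreal_ofReal.aemeasurable]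
    refine ne_top_of_le_ne_top ?_ (ENNReal.tsum_le_tsum hFb)
    rw [← ENNReal.ofReal_tsum_of_nonneg (fun j => by positivity)
      (Real.summable_one_div_nat_pow.2 one_lt_two)]
    exact ENNReal.ofReal_ne_top
  filter_upwards [ae_lt_top (Measurable.tsum fun j => (hF j).ennreal_ofReal) hfin]
    with ω hω
  refine tendsto_average_of_tendsto_average_sq (hb · ω) ?_
  have h0 := ENNReal.tendsto_atTop_zero_of_tsum_ne_top hω.ne
  have h1 : Tendsto (fun j => F j ω) atTop (𝓝 0) := by
    have := (ENNReal.tendsto_toReal ENNReal.zero_ne_top).comp h0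
    refine this.congr fun j => ?_
    exact ENNReal.toReal_ofReal (sq_nonneg _)
  have h2 := h1.sqrt
  rw [Real.sqrt_zero] at h2
  refine (tendsto_zero_iff_abs_tendsto_zero _).2 (h2.congr fun j => ?_)
  exact Real.sqrt_sq_eq_abs _

/-- Deviation of the indicator of `x k = j` from its conditional expectation given the previous
digits. -/
noncomputable def digitDev {m : ℕ} (p : Option (Fin m) → Fin m → ℝ) (j : Fin m) (k : ℕ)
    (x : ℕ → Fin m) : ℝ :=
  (if x k = j then 1 else 0) - p (parentRow x k) j

/-- The sequences whose first `n` digits form the word `w`. -/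
def wordCylinder {m n : ℕ} (w : Fin n → Fin m) : Set (ℕ → Fin m) := {x | ∀ k : Fin n, x k = w k}

theorem wordCylinder_eq_cylinder {m n : ℕ} {w : Fin n → Fin m} {a : ℕ → Fin m}
    (ha : a ∈ wordCylinder w) : wordCylinder w = PiNat.cylinder a n := by
  ext x
  simp only [wordCylinder, Set.mem_ofPred_eq, PiNat.mem_cylinder_iff, Fin.forall_iff] at ha ⊢
  exact forall₂_congr fun k hk => by rw [ha k hk]

theorem measurableSet_wordCylinder {m n : ℕ} (w : Fin n → Fin m) :
    MeasurableSet (wordCylinder w) := by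
  rcases (wordCylinder w).eq_empty_or_nonempty with h | ⟨a, ha⟩
  · rw [h]; exact MeasurableSet.empty
  · rw [wordCylinder_eq_cylinder ha]; exact (PiNat.isOpen_cylinder _ a n).measurableSet

theorem iUnion_wordCylinder (m n : ℕ) : ⋃ w : Fin n → Fin m, wordCylinder w = Set.univ :=
  Set.eq_univ_of_forall fun x => Set.mem_iUnion.2 ⟨fun k => x k, fun _ => rfl⟩

theorem pairwise_disjoint_wordCylinder (m n : ℕ) :
    Pairwise (Function.onFun Disjoint fun w : Fin n → Fin m => wordCylinder w) :=
  fun _ _ hvw => Set.disjoint_left.2 fun _ hv hw =>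
    hvw (funext fun k => (hv k).symm.trans (hw k))

theorem cylWeight_congr {m n : ℕ} {p : Option (Fin m) → Fin m → ℝ} {a b : ℕ → Fin m}
    (h : ∀ i < n, a i = b i) : cylWeight p a n = cylWeight p b n :=
  prod_congr rfl fun k hk => by
    rw [mem_range] at hk
    rw [parentRow_congr fun i hi => h i (hi.trans hk), h k hk]

theorem cylWeight_succ {m : ℕ} (p : Option (Fin m) → Fin m → ℝ) (a : ℕ → Fin m) (n : ℕ) :
    cylWeight p a (n + 1) = cylWeight p a n * p (parentRow a n) (a n) :=
  prod_range_succ _ _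

theorem cylWeight_nonneg {m : ℕ} {p : Option (Fin m) → Fin m → ℝ} (hp0 : ∀ i j, 0 ≤ p i j)
    (a : ℕ → Fin m) (n : ℕ) : 0 ≤ cylWeight p a n :=
  prod_nonneg fun _ _ => hp0 _ _

theorem measurableSet_digit_eq {m : ℕ} (k : ℕ) (j : Fin m) :
    MeasurableSet {x : ℕ → Fin m | x k = j} :=
  (measurable_pi_apply k : Measurable fun x : ℕ → Fin m => x k) (measurableSet_singleton j)

theorem measurable_comp_parentRow {m : ℕ} (g : Option (Fin m) → ℝ) (k : ℕ) :
    Measurable fun x : ℕ → Fin m => g (parentRow x k) := by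
  unfold parentRow
  split_ifs
  · exact measurable_const
  · exact (measurable_of_countable fun i => g (some i)).comp (measurable_pi_apply (k / 2))

theorem measurable_digitDev {m : ℕ} (p : Option (Fin m) → Fin m → ℝ) (j : Fin m) (k : ℕ) :
    Measurable (digitDev p j k) := by
  exact (Measurable.ite (measurableSet_digit_eq k j) measurable_const measurable_const).sub
    (measurable_comp_parentRow (fun r => p r j) k)

theorem abs_digitDev_le_one {m : ℕ} {p : Option (Fin m) → Fin m → ℝ}
    (hp0 : ∀ i j, 0 ≤ p i j) (hp1 : ∀ i, ∑ j, p i j = 1) (j : Fin m) (k : ℕ) (x : ℕ → Fin m) :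
    |digitDev p j k x| ≤ 1 := by
  have h1 : p (parentRow x k) j ≤ 1 := by
    rw [← hp1 (parentRow x k)]
    exact single_le_sum (fun j _ => hp0 _ j) (mem_univ j)
  have h0 := hp0 (parentRow x k) j
  unfold digitDev
  rw [abs_le]
  split_ifs <;> constructor <;> linarith

theorem digitDev_congr {m : ℕ} {p : Option (Fin m) → Fin m → ℝ} {a b : ℕ → Fin m}
    {j : Fin m} {k : ℕ} (h : ∀ i ≤ k, a i = b i) :
    digitDev p j k a = digitDev p j k b := by
  rw [digitDev, digitDev, h k le_rfl, parentRow_congr fun i hi => h i hi.le]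

theorem ae_forall_cylWeight_ne_zero {m : ℕ} {p : Option (Fin m) → Fin m → ℝ}
    {P : Measure (ℕ → Fin m)}
    (hP : ∀ a n, P (PiNat.cylinder a n) = ENNReal.ofReal (cylWeight p a n)) :
    ∀ᵐ x ∂P, ∀ n, cylWeight p x n ≠ 0 := by
  refine ae_all_iff.2 fun n => ?_
  have hsub : {x | ¬ cylWeight p x n ≠ 0} ⊆
      ⋃ w : Fin n → Fin m, wordCylinder w ∩ {x | cylWeight p x n = 0} := by
    rw [← Set.iUnion_inter, iUnion_wordCylinder, Set.univ_inter]
    exact fun x hx => not_not.1 hx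
  refine measure_mono_null hsub (measure_iUnion_null fun w => ?_)
  rcases (wordCylinder w ∩ {x | cylWeight p x n = 0}).eq_empty_or_nonempty with h | ⟨a, ha, h0⟩
  · rw [h]; exact measure_empty
  · refine measure_mono_null Set.inter_subset_left ?_
    rw [wordCylinder_eq_cylinder ha, hP, h0.out, ENNReal.ofReal_zero]

theorem setIntegral_cylinder_digitDev {m : ℕ} {p : Option (Fin m) → Fin m → ℝ}
    (hp0 : ∀ i j, 0 ≤ p i j) {P : Measure (ℕ → Fin m)} [IsProbabilityMeasure P]
    (hP : ∀ a n, P (PiNat.cylinder a n) = ENNReal.ofReal (cylWeight p a n))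
    (a : ℕ → Fin m) (j : Fin m) (n : ℕ) :
    ∫ x in PiNat.cylinder a n, digitDev p j n x ∂P = 0 := by
  have hC := (PiNat.isOpen_cylinder _ a n).measurableSet
  have hj := measurableSet_digit_eq n j
  have hcongr : Set.EqOn (digitDev p j n)
      (fun x => {x : ℕ → Fin m | x n = j}.indicator (fun _ => (1 : ℝ)) x - p (parentRow a n) j)
      (PiNat.cylinder a n) := fun x hx => by
    rw [PiNat.mem_cylinder_iff] at hx
    simp [digitDev, Set.indicator_apply, parentRow_congr hx]
  have hupd : PiNat.cylinder a n ∩ {x | x n = j} =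
      PiNat.cylinder (Function.update a n j) (n + 1) := by
    ext x
    simp only [Set.mem_inter_iff, PiNat.mem_cylinder_iff, Set.mem_ofPred_eq,
      Nat.lt_succ_iff_lt_or_eq, or_imp, forall_and, forall_eq, Function.update_self]
    refine and_congr_left fun _ => forall₂_congr fun i hi => ?_
    rw [Function.update_of_ne hi.ne]
  have hne : ∀ i < n, Function.update a n j i = a i := fun i hi => Function.update_of_ne hi.ne _ _
  rw [setIntegral_congr_fun hC hcongr, integral_sub, setIntegral_indicator hj, hupd]
  · simp only [integral_const, measureReal_def, MeasurableSet.univ, Measure.restrict_apply,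
      Set.univ_inter, hP, smul_eq_mul, mul_one, ENNReal.toReal_ofReal (cylWeight_nonneg hp0 _ _),
      cylWeight_succ, cylWeight_congr hne, parentRow_congr hne, Function.update_self]
    rw [ENNReal.toReal_ofReal (mul_nonneg (cylWeight_nonneg hp0 _ _) (hp0 _ _)), sub_self]
  · exact (integrable_const _).indicator hj
  · exact integrable_const _

theorem integral_digitDev_mul_digitDev {m : ℕ} {p : Option (Fin m) → Fin m → ℝ}
    (hp0 : ∀ i j, 0 ≤ p i j) (hp1 : ∀ i, ∑ j, p i j = 1) {P : Measure (ℕ → Fin m)}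
    [IsProbabilityMeasure P]
    (hP : ∀ a n, P (PiNat.cylinder a n) = ENNReal.ofReal (cylWeight p a n))
    (j : Fin m) {k l : ℕ} (hkl : k < l) :
    ∫ x, digitDev p j k x * digitDev p j l x ∂P = 0 := by
  have hint : Integrable (fun x => digitDev p j k x * digitDev p j l x) P :=
    Integrable.of_bound ((measurable_digitDev p j k).mul
      (measurable_digitDev p j l)).aestronglyMeasurable 1 (ae_of_all _ fun x => by
        rw [Real.norm_eq_abs, abs_mul]
        exact mul_le_one₀ (abs_digitDev_le_one hp0 hp1 j k x) (abs_nonneg _)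
          (abs_digitDev_le_one hp0 hp1 j l x))
  rw [← setIntegral_univ, ← iUnion_wordCylinder m l,
    integral_iUnion_fintype measurableSet_wordCylinder (pairwise_disjoint_wordCylinder m l)
      fun _ => hint.integrableOn]
  refine sum_eq_zero fun w _ => ?_
  rcases (wordCylinder w).eq_empty_or_nonempty with h | ⟨a, ha⟩
  · rw [h]; simp
  · rw [wordCylinder_eq_cylinder ha]
    have hcongr : Set.EqOn (fun x => digitDev p j k x * digitDev p j l x)
        (fun x => digitDev p j k a * digitDev p j l x) (PiNat.cylinder a l) := fun x hx => by
      rw [PiNat.mem_cylinder_iff] at hx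
      simp only
      rw [digitDev_congr fun i hi => hx i (hi.trans_lt hkl)]
    rw [setIntegral_congr_fun (PiNat.isOpen_cylinder _ a l).measurableSet hcongr,
      integral_const_mul, setIntegral_cylinder_digitDev hp0 hP, mul_zero]

theorem ae_forall_tendsto_average_digitDev {m : ℕ} {p : Option (Fin m) → Fin m → ℝ}
    (hp0 : ∀ i j, 0 ≤ p i j) (hp1 : ∀ i, ∑ j, p i j = 1) {P : Measure (ℕ → Fin m)}
    [IsProbabilityMeasure P]
    (hP : ∀ a n, P (PiNat.cylinder a n) = ENNReal.ofReal (cylWeight p a n)) :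
    ∀ᵐ x ∂P, ∀ j, Tendsto (fun n : ℕ => (∑ k ∈ range n, digitDev p j k x) / n) atTop (𝓝 0) :=
  ae_all_iff.2 fun j => ae_tendsto_average_of_orthogonal P (digitDev p j)
    (measurable_digitDev p j) (abs_digitDev_le_one hp0 hp1 j)
    fun _ _ => integral_digitDev_mul_digitDev hp0 hp1 hP j

theorem sum_parentRow {m : ℕ} (g : Option (Fin m) → ℝ) (x : ℕ → Fin m) (n : ℕ) :
    ∑ k ∈ range n, g (parentRow x k) =
      ((n - n / 2 : ℕ) : ℝ) * g none + ∑ k ∈ range (n / 2), g (some (x k)) := by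
  induction n with
  | zero => simp
  | succ n ih =>
    rw [sum_range_succ, ih, parentRow]
    rcases Nat.even_or_odd' n with ⟨j, rfl | rfl⟩
    · have h1 : (2 * j + 1) / 2 = j := by omega
      have h2 : 2 * j + 1 - j = (2 * j - j) + 1 := by omega
      rw [if_pos (even_two_mul j), h1, Nat.mul_div_cancel_left j two_pos, h2]
      push_cast
      ring
    · have h1 : (2 * j + 1) / 2 = j := by omega
      have h2 : (2 * j + 1 + 1) / 2 = j + 1 := by omega
      have h3 : 2 * j + 1 + 1 - (j + 1) = 2 * j + 1 - j := by omega
      have hodd : ¬ Even (2 * j + 1) := Nat.not_even_iff_odd.2 (odd_two_mul_add_one j)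
      rw [if_neg hodd, h1, h2, h3, sum_range_succ]
      ring

/-- The number of occurrences of `j` among the first `n` digits, minus twice the number of
occurrences among the first `n / 2` digits. -/
noncomputable def freqGap {m : ℕ} (x : ℕ → Fin m) (n : ℕ) (j : Fin m) : ℝ :=
  ∑ k ∈ range n, (if x k = j then 1 else 0) - 2 * ∑ k ∈ range (n / 2), if x k = j then 1 else 0

theorem sum_digits_eq_sum_count {m : ℕ} (f : Fin m → ℝ) (x : ℕ → Fin m) (n : ℕ) :
    ∑ k ∈ range n, f (x k) = ∑ i, (∑ k ∈ range n, if x k = i then 1 else 0) * f i := by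
  simp_rw [sum_mul]
  rw [sum_comm]
  simp

theorem sum_freqGap_mul {m : ℕ} (f : Fin m → ℝ) (x : ℕ → Fin m) (n : ℕ) :
    ∑ j, freqGap x n j * f j = ∑ k ∈ range n, f (x k) - 2 * ∑ k ∈ range (n / 2), f (x k) := by
  rw [sum_digits_eq_sum_count f x n, sum_digits_eq_sum_count f x (n / 2), mul_sum,
    ← sum_sub_distrib]
  exact sum_congr rfl fun j _ => by rw [freqGap]; ring

theorem freqGap_eq {m : ℕ} (p : Option (Fin m) → Fin m → ℝ) (x : ℕ → Fin m) (n : ℕ) (j : Fin m) :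
    freqGap x n j = (∑ k ∈ range n, digitDev p j k x - 2 * ∑ k ∈ range (n / 2), digitDev p j k x) +
      (((n - n / 2 : ℕ) : ℝ) - 2 * ((n / 2 - n / 2 / 2 : ℕ) : ℝ)) * p none j +
      ∑ i, freqGap x (n / 2) i * p (some i) j := by
  have hcount : ∀ n, ∑ k ∈ range n, (if x k = j then (1 : ℝ) else 0) =
      ∑ k ∈ range n, digitDev p j k x + (((n - n / 2 : ℕ) : ℝ) * p none j +
        ∑ k ∈ range (n / 2), p (some (x k)) j) := fun n => by
    rw [← sum_parentRow (fun r => p r j), ← sum_add_distrib]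
    exact sum_congr rfl fun k _ => by rw [digitDev]; ring
  rw [sum_freqGap_mul (fun i => p (some i) j), freqGap, hcount n, hcount (n / 2)]
  ring

theorem sum_abs_freqGap_le {m : ℕ} {p : Option (Fin m) → Fin m → ℝ} (hp0 : ∀ i j, 0 ≤ p i j)
    (hp1 : ∀ i, ∑ j, p i j = 1) (x : ℕ → Fin m) (n : ℕ) :
    ∑ j, |freqGap x n j| ≤
      (∑ j, (|∑ k ∈ range n, digitDev p j k x| + 2 * |∑ k ∈ range (n / 2), digitDev p j k x|) + 3) +
        ∑ i, |freqGap x (n / 2) i| := by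
  set c : ℝ := ((n - n / 2 : ℕ) : ℝ) - 2 * ((n / 2 - n / 2 / 2 : ℕ) : ℝ) with hc
  have hc3 : |c| ≤ 3 := by
    have h1 : n - n / 2 ≤ 2 * (n / 2 - n / 2 / 2) + 3 := by omega
    have h2 : 2 * (n / 2 - n / 2 / 2) ≤ n - n / 2 + 3 := by omega
    have h1' : ((n - n / 2 : ℕ) : ℝ) ≤ 2 * ((n / 2 - n / 2 / 2 : ℕ) : ℝ) + 3 := by exact_mod_cast h1
    have h2' : 2 * ((n / 2 - n / 2 / 2 : ℕ) : ℝ) ≤ ((n - n / 2 : ℕ) : ℝ) + 3 := by exact_mod_cast h2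
    rw [abs_le]
    constructor <;> linarith
  have hterm : ∀ j, |freqGap x n j| ≤
      (|∑ k ∈ range n, digitDev p j k x| + 2 * |∑ k ∈ range (n / 2), digitDev p j k x|) +
        3 * p none j + ∑ i, |freqGap x (n / 2) i| * p (some i) j := fun j => by
    rw [freqGap_eq p x n j, ← hc]
    refine (abs_add_le _ _).trans (add_le_add ((abs_add_le _ _).trans (add_le_add ?_ ?_)) ?_)
    · refine (abs_sub _ _).trans_eq ?_
      rw [abs_mul, abs_two]
    · rw [abs_mul, abs_of_nonneg (hp0 _ _)]
      exact mul_le_mul_of_nonneg_right hc3 (hp0 _ _)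
    · refine (abs_sum_le_sum_abs _ _).trans_eq (sum_congr rfl fun i _ => ?_)
      rw [abs_mul, abs_of_nonneg (hp0 _ _)]
  refine (sum_le_sum fun j _ => hterm j).trans_eq ?_
  rw [sum_add_distrib, sum_add_distrib, ← mul_sum, hp1, mul_one, sum_comm (γ := Fin m)]
  simp_rw [← mul_sum, hp1, mul_one]

theorem isLittleO_of_le_add_half {b d : ℕ → ℝ} (hb0 : ∀ n, 0 ≤ b n)
    (hd : d =o[atTop] fun n : ℕ => (n : ℝ)) (h : ∀ n, b n ≤ d n + b (n / 2)) :
    b =o[atTop] fun n : ℕ => (n : ℝ) := by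
  rw [Asymptotics.isLittleO_iff]
  intro ε hε
  obtain ⟨N, hN⟩ := eventually_atTop.1 (Asymptotics.isLittleO_iff.1 hd (by positivity : 0 < ε / 4))
  set C := ∑ n ∈ range (N + 1), b n with hC
  have hC0 : 0 ≤ C := sum_nonneg fun n _ => hb0 n
  have hbound : ∀ n : ℕ, b n ≤ ε / 2 * n + C := by
    intro n
    induction n using Nat.strong_induction_on with
    | _ n ih =>
      rcases le_or_gt n N with hn | hn
      · have h1 : b n ≤ C := single_le_sum (fun n _ => hb0 n) (mem_range.2 (Nat.lt_succ_of_le hn))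
        have h2 : 0 ≤ ε / 2 * n := by positivity
        linarith
      · have h1 := ih (n / 2) (by omega)
        have h2 := hN n hn.le
        have h3 : ((n / 2 : ℕ) : ℝ) ≤ (n : ℝ) / 2 := Nat.cast_div_le
        have h4 : d n ≤ ε / 4 * n := by
          simpa using (le_abs_self _).trans h2
        have h5 : ε / 2 * ((n / 2 : ℕ) : ℝ) ≤ ε / 2 * ((n : ℝ) / 2) := by gcongr
        linarith [h n]
  filter_upwards [tendsto_natCast_atTop_atTop.eventually_ge_atTop (C / (ε / 2))] with n hn
  rw [div_le_iff₀ (by positivity)] at hn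
  rw [Real.norm_eq_abs, abs_of_nonneg (hb0 n), Real.norm_eq_abs, abs_of_nonneg (Nat.cast_nonneg n)]
  linarith [hbound n]

theorem sum_abs_freqGap_isLittleO {m : ℕ} {p : Option (Fin m) → Fin m → ℝ}
    (hp0 : ∀ i j, 0 ≤ p i j) (hp1 : ∀ i, ∑ j, p i j = 1) {x : ℕ → Fin m}
    (hx : ∀ j, Tendsto (fun n : ℕ => (∑ k ∈ range n, digitDev p j k x) / n) atTop (𝓝 0)) :
    (fun n => ∑ j, |freqGap x n j|) =o[atTop] fun n : ℕ => (n : ℝ) := by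
  have hM : ∀ j, (fun n => |∑ k ∈ range n, digitDev p j k x|) =o[atTop] fun n : ℕ => (n : ℝ) :=
    fun j => ((Asymptotics.isLittleO_iff_tendsto' (by
      filter_upwards [eventually_gt_atTop 0] with n hn h0
      exact absurd h0 (by positivity))).2 (hx j)).abs_left
  have hhalf : Tendsto (fun n : ℕ => n / 2) atTop atTop := Nat.tendsto_div_const_atTop two_ne_zero
  have hhalfO : (fun n : ℕ => ((n / 2 : ℕ) : ℝ)) =O[atTop] fun n : ℕ => (n : ℝ) :=
    Asymptotics.isBigO_of_le _ fun n => by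
      simp only [Real.norm_natCast]
      exact_mod_cast Nat.div_le_self n 2
  refine isLittleO_of_le_add_half (fun n => sum_nonneg fun _ _ => abs_nonneg _) ?_
    (sum_abs_freqGap_le hp0 hp1 x)
  refine Asymptotics.IsLittleO.add (Asymptotics.IsLittleO.fun_sum fun j _ => (hM j).add ?_) ?_
  · exact (((hM j).comp_tendsto hhalf).trans_isBigO hhalfO).const_mul_left 2
  · exact Asymptotics.isLittleO_const_left.2 (Or.inr
      (tendsto_norm_atTop_atTop.comp tendsto_natCast_atTop_atTop))

theorem ediam_image_ofDigits_cylinder_le {m : ℕ} (a : ℕ → Fin m) (n : ℕ) :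
    Metric.ediam (Real.ofDigits '' PiNat.cylinder a n) ≤ ((m : ℝ≥0∞)⁻¹) ^ n := by
  have hm : 0 < m := Fin.pos (a 0)
  have hcast : ((m : ℝ≥0∞)⁻¹) ^ n = ENNReal.ofReal (((m : ℝ) ^ n)⁻¹) := by
    rw [ENNReal.ofReal_inv_of_pos (by positivity), ENNReal.ofReal_pow (by positivity),
      ENNReal.ofReal_natCast, ENNReal.inv_pow]
  refine Metric.ediam_le ?_
  rintro _ ⟨x, hx, rfl⟩ _ ⟨y, hy, rfl⟩
  rw [PiNat.mem_cylinder_iff] at hx hy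
  rw [edist_dist, Real.dist_eq, hcast]
  exact ENNReal.ofReal_le_ofReal
    (Real.abs_ofDigits_sub_ofDigits_le fun i hi => (hx i hi).trans (hy i hi).symm)

theorem tendsto_inv_natCast_pow {m : ℕ} (hm : 2 ≤ m) :
    Tendsto (fun n : ℕ => ((m : ℝ≥0∞)⁻¹) ^ n) atTop (𝓝 0) :=
  ENNReal.tendsto_pow_atTop_nhds_zero_of_lt_one
    (ENNReal.inv_lt_one.2 (by exact_mod_cast hm))

theorem hausdorffMeasure_image_ofDigits_ne_top {m : ℕ} (hm : 2 ≤ m) (P : Measure (ℕ → Fin m))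
    [IsProbabilityMeasure P] {E : Set (ℕ → Fin m)} {s s' : ℝ} (hs' : 0 ≤ s') (hss : s' < s)
    (hE : ∀ x ∈ E, ∀ N, ∃ n ≥ N, (((m : ℝ≥0∞)⁻¹) ^ n) ^ s' ≤ P (PiNat.cylinder x n)) :
    μH[s] (Real.ofDigits '' E) ≠ ∞ := by
  have hs : 0 < s := hs'.trans_lt hss
  have hm0 : (m : ℝ≥0∞)⁻¹ ≠ 0 := ENNReal.inv_ne_zero.2 (ENNReal.natCast_ne_top m)
  have hmtop : (m : ℝ≥0∞)⁻¹ ≠ ∞ := ENNReal.inv_ne_top.2 (by exact_mod_cast (by omega : m ≠ 0))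
  set y : ℝ≥0∞ := (m : ℝ≥0∞)⁻¹ with hy
  have hy1 : y < 1 := ENNReal.inv_lt_one.2 (by exact_mod_cast hm)
  set c : ℝ≥0∞ := y ^ (s - s') with hc
  have hc1 : c < 1 := ENNReal.rpow_lt_one hy1 (sub_pos.2 hss)
  classical
  let cover : ∀ N : ℕ, (Σ n : ℕ, Fin n → Fin m) → Set ℝ := fun N q =>
    if N ≤ q.1 ∧ (y ^ q.1) ^ s' ≤ P (wordCylinder q.2) then Real.ofDigits '' wordCylinder q.2 else ∅
  have hdiam : ∀ (n : ℕ) (w : Fin n → Fin m),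
      Metric.ediam (Real.ofDigits '' wordCylinder w) ≤ y ^ n := fun n w => by
    rcases (wordCylinder w).eq_empty_or_nonempty with h | ⟨a, ha⟩
    · simp [h]
    · rw [wordCylinder_eq_cylinder ha]; exact ediam_image_ofDigits_cylinder_le a n
  have hterm : ∀ N (q : Σ n : ℕ, Fin n → Fin m),
      Metric.ediam (cover N q) ^ s ≤ c ^ q.1 * P (wordCylinder q.2) := by
    rintro N ⟨n, w⟩
    simp only [cover]
    split_ifs with h
    · calc Metric.ediam (Real.ofDigits '' wordCylinder w) ^ s ≤ (y ^ n) ^ s :=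
            ENNReal.rpow_le_rpow (hdiam n w) hs.le
        _ = c ^ n * (y ^ n) ^ s' := by
            rw [hc, ← ENNReal.rpow_natCast, ← ENNReal.rpow_natCast, ← ENNReal.rpow_mul,
              ← ENNReal.rpow_mul, ← ENNReal.rpow_mul, ← ENNReal.rpow_add _ _ hm0 hmtop]
            congr 1; ring
        _ ≤ c ^ n * P (wordCylinder w) := by gcongr; exact h.2
    · simp [ENNReal.zero_rpow_of_pos hs]
  have hsum : ∀ N, ∑' q, Metric.ediam (cover N q) ^ s ≤ (1 - c)⁻¹ := fun N => by
    refine (ENNReal.tsum_le_tsum (hterm N)).trans ?_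
    rw [ENNReal.tsum_sigma', ← ENNReal.tsum_geometric]
    refine ENNReal.tsum_le_tsum fun n => ?_
    dsimp only
    rw [ENNReal.tsum_mul_left, ← measure_iUnion (pairwise_disjoint_wordCylinder m n)
      measurableSet_wordCylinder, iUnion_wordCylinder, measure_univ, mul_one]
  have hle := Measure.hausdorffMeasure_le_liminf_tsum s (Real.ofDigits '' E) (l := atTop)
    (fun n : ℕ => y ^ n) (tendsto_inv_natCast_pow hm) cover
    (Eventually.of_forall fun N ⟨n, w⟩ => by
      simp only [cover]
      split_ifs with h
      · exact (hdiam n w).trans (pow_le_pow_right_of_le_one' hy1.le h.1)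
      · simp)
    (Eventually.of_forall fun N => by
      rintro _ ⟨x, hx, rfl⟩
      obtain ⟨n, hn, hxn⟩ := hE x hx N
      have hmem : x ∈ wordCylinder fun k : Fin n => x k := fun _ => rfl
      refine Set.mem_iUnion.2 ⟨⟨n, fun k => x k⟩, ?_⟩
      simp only [cover]
      rw [if_pos ⟨hn, by rwa [wordCylinder_eq_cylinder hmem]⟩]
      exact Set.mem_image_of_mem _ hmem)
  refine ne_top_of_le_ne_top ?_ (hle.trans (liminf_le_of_frequently_le'
    (Frequently.of_forall hsum)))
  exact ENNReal.inv_ne_top.2 (tsub_pos_of_lt hc1).ne'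

/-- The integer with base-`m` digits `x 0, …, x (n - 1)`, most significant first. -/
def prefixValue {m : ℕ} (x : ℕ → Fin m) : ℕ → ℕ
  | 0 => 0
  | n + 1 => m * prefixValue x n + x n

theorem ofDigits_eq_prefixValue {m : ℕ} (x : ℕ → Fin m) (n : ℕ) :
    (m : ℝ) ^ n * Real.ofDigits x = prefixValue x n + Real.ofDigits fun i => x (i + n) := by
  have hm : (m : ℝ) ≠ 0 := by exact_mod_cast (Fin.pos (x 0)).ne'
  have hsum : (m : ℝ) ^ n * ∑ i ∈ range n, Real.ofDigitsTerm x i = prefixValue x n := by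
    induction n with
    | zero => simp [prefixValue]
    | succ n ih =>
      rw [sum_range_succ, mul_add, pow_succ', mul_assoc, ih, prefixValue, Real.ofDigitsTerm]
      push_cast
      field_simp
      ring
  rw [Real.ofDigits_eq_sum_add_ofDigits x n, mul_add, hsum, mul_inv_cancel_left₀ (pow_ne_zero n hm)]

theorem eq_of_prefixValue_eq {m : ℕ} {x y : ℕ → Fin m} {n : ℕ}
    (h : prefixValue x n = prefixValue y n) : ∀ i < n, x i = y i := by
  induction n with
  | zero => simp
  | succ n ih =>
    have hm : 0 < m := Fin.pos (x 0)
    simp only [prefixValue] at h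
    have hmod := congrArg (· % m) h
    have hdiv := congrArg (· / m) h
    simp only [Nat.mul_add_mod, Nat.mod_eq_of_lt (x n).2, Nat.mod_eq_of_lt (y n).2] at hmod
    simp only [Nat.mul_add_div hm, Nat.div_eq_of_lt (x n).2, Nat.div_eq_of_lt (y n).2] at hdiv
    intro i hi
    rcases Nat.lt_succ_iff_lt_or_eq.1 hi with hi | rfl
    · exact ih hdiv i hi
    · exact Fin.ext hmod

theorem measure_preimage_ofDigits_inter_le {m : ℕ} (hm : 2 ≤ m) (P : Measure (ℕ → Fin m))
    {E : Set (ℕ → Fin m)} {U : Set ℝ} {n : ℕ} {c : ℝ≥0∞}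
    (hE : ∀ x ∈ E, P (PiNat.cylinder x n) ≤ c) (hU : Metric.ediam U ≤ ((m : ℝ≥0∞)⁻¹) ^ n) :
    P (Real.ofDigits ⁻¹' U ∩ E) ≤ 5 * c := by
  rcases (Real.ofDigits ⁻¹' U ∩ E).eq_empty_or_nonempty with h | ⟨x₀, hx₀U, hx₀E⟩
  · simp [h]
  have hm0 : (0 : ℝ) < m := by exact_mod_cast (by omega : 0 < m)
  have hcast : ((m : ℝ≥0∞)⁻¹) ^ n = ENNReal.ofReal (((m : ℝ) ^ n)⁻¹) := by
    rw [ENNReal.ofReal_inv_of_pos (by positivity), ENNReal.ofReal_pow (by positivity),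
      ENNReal.ofReal_natCast, ENNReal.inv_pow]
  set v := prefixValue x₀ n with hv
  have hsub : Real.ofDigits ⁻¹' U ∩ E ⊆
      ⋃ k ∈ Icc (v - 2) (v + 2), {x | x ∈ E ∧ prefixValue x n = k} := by
    rintro x ⟨hxU, hxE⟩
    have hdist : |Real.ofDigits x - Real.ofDigits x₀| ≤ ((m : ℝ) ^ n)⁻¹ := by
      have := (Metric.edist_le_ediam_of_mem (Set.mem_preimage.1 hxU)
        (Set.mem_preimage.1 hx₀U)).trans hU
      rw [edist_dist, Real.dist_eq, hcast] at this
      exact (ENNReal.ofReal_le_ofReal_iff (by positivity)).1 this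
    have hscaled : |(m : ℝ) ^ n * Real.ofDigits x - (m : ℝ) ^ n * Real.ofDigits x₀| ≤ 1 := by
      rw [← mul_sub, abs_mul, abs_of_pos (pow_pos hm0 n)]
      calc _ ≤ (m : ℝ) ^ n * ((m : ℝ) ^ n)⁻¹ := by gcongr
        _ = 1 := mul_inv_cancel₀ (by positivity)
    rw [ofDigits_eq_prefixValue, ofDigits_eq_prefixValue, abs_le] at hscaled
    have h1 := Real.ofDigits_nonneg fun i => x (i + n)
    have h2 := Real.ofDigits_le_one fun i => x (i + n)
    have h3 := Real.ofDigits_nonneg fun i => x₀ (i + n)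
    have h4 := Real.ofDigits_le_one fun i => x₀ (i + n)
    have h5 : (v : ℝ) ≤ (prefixValue x n : ℝ) + 2 := by linarith [hscaled.1]
    have h6 : (prefixValue x n : ℝ) ≤ (v : ℝ) + 2 := by linarith [hscaled.2]
    have h5' : v ≤ prefixValue x n + 2 := by exact_mod_cast h5
    have h6' : prefixValue x n ≤ v + 2 := by exact_mod_cast h6
    simp only [Set.mem_iUnion]
    exact ⟨prefixValue x n, mem_Icc.2 ⟨by omega, h6'⟩, hxE, rfl⟩
  have hpiece : ∀ k, P {x | x ∈ E ∧ prefixValue x n = k} ≤ c := fun k => by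
    rcases {x | x ∈ E ∧ prefixValue x n = k}.eq_empty_or_nonempty with h | ⟨a, haE, hak⟩
    · rw [h, measure_empty]; exact zero_le
    · refine (measure_mono ?_).trans (hE a haE)
      rintro x ⟨-, hxk⟩
      exact PiNat.mem_cylinder_iff.2 (eq_of_prefixValue_eq (hxk.trans hak.symm))
  calc P (Real.ofDigits ⁻¹' U ∩ E) ≤ ∑ k ∈ Icc (v - 2) (v + 2), c :=
        (measure_mono hsub).trans ((measure_biUnion_finset_le _ _).trans
          (sum_le_sum fun k _ => hpiece k))
    _ ≤ 5 * c := by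
        rw [sum_const, nsmul_eq_mul, Nat.card_Icc]
        gcongr
        exact_mod_cast (by omega : v + 2 + 1 - (v - 2) ≤ 5)

theorem hausdorffMeasure_image_ofDigits_ne_zero {m : ℕ} (hm : 2 ≤ m) (P : Measure (ℕ → Fin m))
    {E : Set (ℕ → Fin m)} {s : ℝ} (hs : 0 < s) {N : ℕ} (hPE : P E ≠ 0)
    (hE : ∀ x ∈ E, ∀ n ≥ N, P (PiNat.cylinder x n) ≤ (((m : ℝ≥0∞)⁻¹) ^ n) ^ s) :
    μH[s] (Real.ofDigits '' E) ≠ 0 := by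
  have hm0 : (m : ℝ≥0∞) ≠ 0 := by exact_mod_cast (by omega : m ≠ 0)
  have hmtop : (m : ℝ≥0∞) ≠ ∞ := ENNReal.natCast_ne_top m
  have hmeas : Measurable (Real.ofDigits : (ℕ → Fin m) → ℝ) := Real.continuous_ofDigits.measurable
  set y : ℝ≥0∞ := (m : ℝ≥0∞)⁻¹ with hy
  set C : ℝ≥0∞ := 5 * (m : ℝ≥0∞) ^ s with hC
  have hCtop : C ≠ ∞ :=
    ENNReal.mul_ne_top (by norm_num) (ENNReal.rpow_ne_top_of_nonneg hs.le hmtop)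
  have hC0 : C ≠ 0 := mul_ne_zero (by norm_num) (by simp [hm0, hmtop])
  have hball : ∀ U : Set ℝ, Metric.ediam U ≤ y ^ N →
      P (Real.ofDigits ⁻¹' U ∩ E) ≤ C * Metric.ediam U ^ s := by
    intro U hU
    rcases eq_or_ne (Metric.ediam U) 0 with h0 | h0
    · have hlim : Tendsto (fun n : ℕ => 5 * (y ^ n) ^ s) atTop (𝓝 0) := by
        have h1 := ((ENNReal.continuous_rpow_const (y := s)).tendsto 0).comp
          (tendsto_inv_natCast_pow hm)
        rw [ENNReal.zero_rpow_of_pos hs] at h1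
        simpa using ENNReal.Tendsto.const_mul h1 (Or.inr (by norm_num : (5 : ℝ≥0∞) ≠ ∞))
      refine (ge_of_tendsto hlim ?_).trans zero_le
      filter_upwards [eventually_ge_atTop N] with n hn
      exact measure_preimage_ofDigits_inter_le hm P (fun x hx => hE x hx n hn)
        (by rw [h0]; exact zero_le)
    · have hex : ∃ n, N ≤ n ∧ y ^ (n + 1) < Metric.ediam U :=
        ((eventually_ge_atTop N).and (((tendsto_inv_natCast_pow hm).comp
          (tendsto_add_atTop_nat 1)).eventually_lt_const h0.bot_lt)).exists
      classical
      obtain ⟨hn, hlt⟩ := Nat.find_spec hex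
      set n := Nat.find hex with hndef
      have hle : Metric.ediam U ≤ y ^ n := by
        rcases hn.eq_or_lt with h | h
        · rwa [← h]
        · obtain ⟨k, hk⟩ : ∃ k, n = k + 1 := ⟨n - 1, by omega⟩
          have := Nat.find_min hex (m := k) (by omega)
          rw [hk]
          exact not_lt.1 fun hlt' => this ⟨by omega, hlt'⟩
      calc P (Real.ofDigits ⁻¹' U ∩ E) ≤ 5 * (y ^ n) ^ s :=
            measure_preimage_ofDigits_inter_le hm P (fun x hx => hE x hx n hn) hle
        _ = C * (y ^ (n + 1)) ^ s := by
            rw [hC, mul_assoc, ← ENNReal.mul_rpow_of_nonneg _ _ hs.le, pow_succ', ← mul_assoc, hy,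
              ENNReal.mul_inv_cancel hm0 hmtop, one_mul]
        _ ≤ C * Metric.ediam U ^ s := by gcongr
  set ν : Measure ℝ := C⁻¹ • (P.restrict E).map Real.ofDigits with hν
  have hνle : ν ≤ μH[s] := by
    refine Measure.le_hausdorffMeasure s ν (y ^ N)
      (ENNReal.pow_pos (ENNReal.inv_pos.2 hmtop) N) fun U hU => ?_
    rw [← Metric.ediam_closure] at hU ⊢
    have hcl : MeasurableSet (closure U) := isClosed_closure.measurableSet
    calc ν U ≤ ν (closure U) := measure_mono subset_closure
      _ = C⁻¹ * P (Real.ofDigits ⁻¹' closure U ∩ E) := by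
          rw [hν, Measure.smul_apply, Measure.map_apply hmeas hcl,
            Measure.restrict_apply (hmeas hcl), smul_eq_mul]
      _ ≤ C⁻¹ * (C * Metric.ediam (closure U) ^ s) := by gcongr; exact hball _ hU
      _ = Metric.ediam (closure U) ^ s := by
          rw [← mul_assoc, ENNReal.inv_mul_cancel hC0 hCtop, one_mul]
  refine ((pos_iff_ne_zero.2 ?_).trans_le (hνle _)).ne'
  rw [hν, Measure.smul_apply, smul_eq_mul]
  refine mul_ne_zero (ENNReal.inv_ne_zero.2 hCtop) (ne_of_gt ?_)
  calc 0 < P E := pos_iff_ne_zero.2 hPE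
    _ = P.restrict E E := (Measure.restrict_apply_self P E).symm
    _ ≤ P.restrict E (Real.ofDigits ⁻¹' (Real.ofDigits '' E)) :=
        measure_mono (Set.subset_preimage_image _ _)
    _ ≤ _ := Measure.le_map_apply hmeas.aemeasurable _

/-- The normalizing constant of a row of the transition table. -/
def rowNorm {m : ℕ} (t : Fin m → ℝ) : Option (Fin m) → ℝ
  | none => ∑ i, t i
  | some i => t i ^ 2

/-- The indicator of the digits allowed after a given row. -/
def rowAllowed {m : ℕ} (A : Matrix (Fin m) (Fin m) ℝ) : Option (Fin m) → Fin m → ℝ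
  | none, _ => 1
  | some i, j => A i j

/-- The transition table of the measure of maximal dimension. -/
noncomputable def transProb {m : ℕ} (A : Matrix (Fin m) (Fin m) ℝ) (t : Fin m → ℝ)
    (r : Option (Fin m)) (j : Fin m) : ℝ :=
  rowAllowed A r j * (t j / rowNorm t r)

theorem rowNorm_pos {m : ℕ} {t : Fin m → ℝ} (ht : ∀ i, 0 < t i) (hm : 0 < m)
    (r : Option (Fin m)) : 0 < rowNorm t r := by
  rcases r with _ | i
  · have : Nonempty (Fin m) := ⟨⟨0, hm⟩⟩
    exact sum_pos (fun i _ => ht i) univ_nonempty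
  · exact pow_pos (ht i) 2

theorem rowAllowed_eq_zero_or_one {m : ℕ} {A : Matrix (Fin m) (Fin m) ℝ}
    (hA : ∀ i j, A i j = 0 ∨ A i j = 1) (r : Option (Fin m)) (j : Fin m) :
    rowAllowed A r j = 0 ∨ rowAllowed A r j = 1 := by
  rcases r with _ | i
  · exact Or.inr rfl
  · exact hA i j

theorem transProb_nonneg {m : ℕ} {A : Matrix (Fin m) (Fin m) ℝ}
    (hA : ∀ i j, A i j = 0 ∨ A i j = 1) {t : Fin m → ℝ} (ht : ∀ i, 0 < t i)
    (r : Option (Fin m)) (j : Fin m) : 0 ≤ transProb A t r j := by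
  have := div_pos (ht j) (rowNorm_pos ht (Fin.pos j) r)
  rcases rowAllowed_eq_zero_or_one hA r j with h | h <;> simp [transProb, h, this.le]

theorem transProb_le {m : ℕ} {A : Matrix (Fin m) (Fin m) ℝ}
    (hA : ∀ i j, A i j = 0 ∨ A i j = 1) {t : Fin m → ℝ} (ht : ∀ i, 0 < t i)
    (r : Option (Fin m)) (j : Fin m) : transProb A t r j ≤ t j / rowNorm t r := by
  have := div_pos (ht j) (rowNorm_pos ht (Fin.pos j) r)
  rcases rowAllowed_eq_zero_or_one hA r j with h | h <;> simp [transProb, h, this.le]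

theorem sum_transProb {m : ℕ} (hm : 0 < m) {A : Matrix (Fin m) (Fin m) ℝ} {t : Fin m → ℝ}
    (ht : ∀ i, 0 < t i) (hAt : ∀ i, t i ^ 2 = ∑ j, A i j * t j) (r : Option (Fin m)) :
    ∑ j, transProb A t r j = 1 := by
  have hr := (rowNorm_pos ht hm r).ne'
  simp_rw [transProb, ← mul_div_assoc]
  rw [← sum_div, div_eq_one_iff_eq hr]
  rcases r with _ | i
  · simp [rowAllowed, rowNorm]
  · exact (hAt i).symm

theorem prod_div_rowNorm {m : ℕ} {t : Fin m → ℝ} (ht : ∀ i, 0 < t i) (x : ℕ → Fin m) (n : ℕ) :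
    ∏ k ∈ range n, t (x k) / rowNorm t (parentRow x k) =
      Real.exp (∑ k ∈ range n, Real.log (t (x k)) - 2 * ∑ k ∈ range (n / 2), Real.log (t (x k)) -
        ((n - n / 2 : ℕ) : ℝ) * Real.log (∑ i, t i)) := by
  have hrow : ∑ k ∈ range n, Real.log (rowNorm t (parentRow x k)) =
      ((n - n / 2 : ℕ) : ℝ) * Real.log (∑ i, t i) +
        2 * ∑ k ∈ range (n / 2), Real.log (t (x k)) := by
    rw [sum_parentRow fun r => Real.log (rowNorm t r)]
    simp [rowNorm, mul_sum]
  have hexp : ∀ k ∈ range n, t (x k) / rowNorm t (parentRow x k) =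
      Real.exp (Real.log (t (x k)) - Real.log (rowNorm t (parentRow x k))) := fun k _ => by
    rw [Real.exp_sub, Real.exp_log (ht _),
      Real.exp_log (rowNorm_pos ht (Fin.pos (x 0)) _)]
  rw [prod_congr rfl hexp, ← Real.exp_sum, sum_sub_distrib, hrow]
  congr 1
  ring

theorem rowAllowed_parentRow {m : ℕ} {A : Matrix (Fin m) (Fin m) ℝ} {x : ℕ → Fin m}
    (hx : ∀ k, A (x k) (x (2 * k + 1)) = 1) (k : ℕ) : rowAllowed A (parentRow x k) (x k) = 1 := by
  rcases Nat.even_or_odd' k with ⟨j, rfl | rfl⟩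
  · simp [parentRow, rowAllowed]
  · have h : (2 * j + 1) / 2 = j := by omega
    simp [parentRow, rowAllowed, h, hx j]

theorem apply_eq_one_of_cylWeight_ne_zero {m : ℕ} {A : Matrix (Fin m) (Fin m) ℝ}
    (hA : ∀ i j, A i j = 0 ∨ A i j = 1) {t : Fin m → ℝ} {x : ℕ → Fin m}
    (hx : ∀ n, cylWeight (transProb A t) x n ≠ 0) (k : ℕ) : A (x k) (x (2 * k + 1)) = 1 := by
  refine (hA _ _).resolve_left fun h => hx (2 * k + 2) ?_
  refine prod_eq_zero (mem_range.2 (by omega : 2 * k + 1 < 2 * k + 2)) ?_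
  have h2 : (2 * k + 1) / 2 = k := by omega
  simp [transProb, parentRow, rowAllowed, h2, h]

theorem exists_ge_two_mul_sub_le {S : ℕ → ℝ} (hS : ∀ n, 0 ≤ S n) {δ : ℝ} (hδ : 0 < δ) (N : ℕ) :
    ∃ n ≥ N, 2 * S n - S (2 * n) ≤ δ * n := by
  by_contra! h
  have hbound : ∀ i : ℕ, S (2 ^ (N + i)) ≤ 2 ^ i * S (2 ^ N) - i * (2 ^ (N + i) * (δ / 2)) := by
    intro i
    induction i with
    | zero => simp
    | succ i ih =>
      have hN : N ≤ 2 ^ (N + i) := (Nat.lt_two_pow_self.le).trans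
        (Nat.pow_le_pow_right (by norm_num) (Nat.le_add_right N i))
      have := h _ hN
      rw [← add_assoc N i 1, pow_succ' 2 (N + i), pow_succ' 2 (N + i), pow_succ' 2 i]
      push_cast at this ⊢
      linarith
  obtain ⟨i, hi⟩ := exists_nat_gt (S (2 ^ N) / (δ / 2))
  rw [div_lt_iff₀ (by positivity)] at hi
  have h1 := (hS _).trans (hbound i)
  have h2 : (1 : ℝ) ≤ 2 ^ N := one_le_pow₀ (by norm_num)
  rw [pow_add] at h1
  have h3 : (0 : ℝ) < 2 ^ i := by positivity
  have h4 : (0 : ℝ) ≤ i * (δ / 2) := by positivity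
  have h5 : S (2 ^ N) < 2 ^ N * (i * (δ / 2)) := hi.trans_le (le_mul_of_one_le_left h4 h2)
  nlinarith [mul_pos h3 (sub_pos.2 h5)]

theorem inv_natCast_pow_rpow {m : ℕ} (hm : 0 < m) (n : ℕ) (s : ℝ) (hs : 0 ≤ s) :
    (((m : ℝ≥0∞)⁻¹) ^ n) ^ s = ENNReal.ofReal (Real.exp (-(s * Real.log m) * n)) := by
  have hm' : (0 : ℝ) < m := by exact_mod_cast hm
  have hcast : ((m : ℝ≥0∞)⁻¹) ^ n = ENNReal.ofReal (Real.exp (-(Real.log m * n))) := by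
    rw [Real.exp_neg, ENNReal.ofReal_inv_of_pos (Real.exp_pos _), mul_comm, Real.exp_nat_mul,
      Real.exp_log hm', ENNReal.ofReal_pow hm'.le, ENNReal.ofReal_natCast, ENNReal.inv_pow]
  rw [hcast, ENNReal.ofReal_rpow_of_nonneg (Real.exp_pos _).le hs, ← Real.exp_mul]
  congr 2
  ring

theorem XiA_eq_image_ofDigits (m : ℕ) (A : Matrix (Fin m) (Fin m) ℝ) :
    XiA m A = Real.ofDigits '' {a : ℕ → Fin m | ∀ k, A (a k) (a (2 * k + 1)) = 1} := by
  ext x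
  simp only [XiA, Set.mem_image, Set.mem_ofPred_eq, Real.ofDigits, Real.ofDigitsTerm,
    div_eq_mul_inv]
  exact exists_congr fun a => and_congr_right fun _ => eq_comm

theorem exists_exp_le_cylWeight {m : ℕ} {A : Matrix (Fin m) (Fin m) ℝ} {t : Fin m → ℝ}
    (ht : ∀ i, 1 < t i) {x : ℕ → Fin m} (hx : ∀ k, A (x k) (x (2 * k + 1)) = 1) {σ : ℝ}
    (hσ : Real.log (∑ i, t i) < 2 * σ) (N : ℕ) :
    ∃ n ≥ N, Real.exp (-σ * n) ≤ cylWeight (transProb A t) x n := by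
  obtain ⟨n, hn, hle⟩ := exists_ge_two_mul_sub_le
    (S := fun n => ∑ k ∈ range n, Real.log (t (x k)))
    (fun n => sum_nonneg fun k _ => Real.log_nonneg (ht _).le) (sub_pos.2 hσ) N
  refine ⟨2 * n, by omega, ?_⟩
  have heq : cylWeight (transProb A t) x (2 * n) =
      ∏ k ∈ range (2 * n), t (x k) / rowNorm t (parentRow x k) :=
    prod_congr rfl fun k _ => by rw [transProb, rowAllowed_parentRow hx, one_mul]
  have h1 : 2 * n / 2 = n := by omega
  have h2 : 2 * n - n = n := by omega
  rw [heq, prod_div_rowNorm (fun i => one_pos.trans (ht i)), h1, h2, Real.exp_le_exp]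
  push_cast
  linarith

theorem eventually_cylWeight_le_exp {m : ℕ} {A : Matrix (Fin m) (Fin m) ℝ}
    (hA : ∀ i j, A i j = 0 ∨ A i j = 1) {t : Fin m → ℝ} (ht : ∀ i, 0 < t i)
    (hT : 1 ≤ ∑ i, t i) {x : ℕ → Fin m}
    (hx : (fun n => ∑ j, |freqGap x n j|) =o[atTop] fun n : ℕ => (n : ℝ)) {σ : ℝ}
    (hσ : 2 * σ < Real.log (∑ i, t i)) :
    ∀ᶠ n : ℕ in atTop, cylWeight (transProb A t) x n ≤ Real.exp (-σ * n) := by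
  set C := ∑ j, |Real.log (t j)| with hC
  have hC0 : 0 ≤ C := sum_nonneg fun _ _ => abs_nonneg _
  have hδ : 0 < (Real.log (∑ i, t i) - 2 * σ) / (2 * (C + 1)) :=
    div_pos (sub_pos.2 hσ) (by positivity)
  filter_upwards [Asymptotics.isLittleO_iff.1 hx hδ] with n hn
  set G := ∑ j, |freqGap x n j| with hG
  have hG0 : 0 ≤ G := sum_nonneg fun _ _ => abs_nonneg _
  rw [Real.norm_of_nonneg hG0, Real.norm_of_nonneg n.cast_nonneg] at hn
  have hgap : ∑ k ∈ range n, Real.log (t (x k)) - 2 * ∑ k ∈ range (n / 2), Real.log (t (x k)) ≤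
      G * C := by
    rw [← sum_freqGap_mul fun j => Real.log (t j), hG, sum_mul]
    refine sum_le_sum fun j _ => (le_abs_self _).trans ?_
    rw [abs_mul]
    gcongr
    exact single_le_sum (f := fun j => |Real.log (t j)|) (fun _ _ => abs_nonneg _) (mem_univ j)
  have hGC : G * C ≤ (Real.log (∑ i, t i) - 2 * σ) / 2 * n := by
    calc G * C ≤ G * (C + 1) := by gcongr; linarith
      _ ≤ (Real.log (∑ i, t i) - 2 * σ) / (2 * (C + 1)) * n * (C + 1) := by gcongr
      _ = _ := by field_simp
  have hhalf : (n : ℝ) / 2 ≤ ((n - n / 2 : ℕ) : ℝ) := by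
    have : n ≤ 2 * (n - n / 2) := by omega
    have : (n : ℝ) ≤ 2 * ((n - n / 2 : ℕ) : ℝ) := by exact_mod_cast this
    linarith
  calc cylWeight (transProb A t) x n
      ≤ ∏ k ∈ range n, t (x k) / rowNorm t (parentRow x k) :=
        prod_le_prod (fun k _ => transProb_nonneg hA ht _ _) fun k _ => transProb_le hA ht _ _
    _ ≤ Real.exp (-σ * n) := by
        rw [prod_div_rowNorm ht, Real.exp_le_exp]
        have := mul_le_mul_of_nonneg_right hhalf (Real.log_nonneg hT)
        linarith

/-- The Hausdorff dimension of `Ξ_A` is `(1/2) log_m (∑ i, t_i)`, where `(t_i)` is the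
unique vector with `t_i > 1` and `t_i² = ∑_j A(i,j) t_j`. -/
theorem dimH_XiA (m : ℕ) (hm : 2 ≤ m) (A : Matrix (Fin m) (Fin m) ℝ)
    (hA01 : ∀ i j, A i j = 0 ∨ A i j = 1)
    (hprim : ∃ N : ℕ, 1 ≤ N ∧ ∀ i j, 0 < (A ^ N) i j)
    (t : Fin m → ℝ) (ht1 : ∀ i, 1 < t i) (ht2 : ∀ i, t i ^ 2 = ∑ j, A i j * t j) :
    dimH (XiA m A) = ENNReal.ofReal ((1 / 2) * Real.logb m (∑ i, t i)) := by
  have hm0 : 0 < m := by omega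
  have ht0 : ∀ i, 0 < t i := fun i => one_pos.trans (ht1 i)
  have hL : 0 < Real.log m := Real.log_pos (by exact_mod_cast (by omega : 1 < m))
  have hT : 1 ≤ ∑ i, t i := by
    calc (1 : ℝ) ≤ t ⟨0, hm0⟩ := (ht1 _).le
      _ ≤ ∑ i, t i := single_le_sum (fun i _ => (ht0 i).le) (mem_univ _)
  set d : ℝ := (1 / 2) * Real.logb m (∑ i, t i) with hd
  have hdL : 2 * (d * Real.log m) = Real.log (∑ i, t i) := by
    rw [hd, Real.logb]; field_simp
  have hd0 : 0 ≤ d := by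
    have := Real.log_nonneg hT
    nlinarith
  have hp0 := transProb_nonneg hA01 ht0
  obtain ⟨P, hPprob, hP⟩ := exists_measure_cylinder_eq_cylWeight (transProb A t) hp0
    (sum_transProb hm0 ht0 ht2)
  rw [XiA_eq_image_ofDigits]
  refine le_antisymm (dimH_le fun s hs => ?_) (ENNReal.le_of_forall_nnreal_lt fun s hs => ?_)
  · by_contra! hlt
    obtain ⟨s', hds', hs's⟩ := exists_between (ENNReal.ofReal_lt_coe_iff hd0 |>.1 hlt)
    refine hausdorffMeasure_image_ofDigits_ne_top hm P (hd0.trans hds'.le) hs's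
      (fun x hx N => ?_) hs
    obtain ⟨n, hn, hle⟩ := exists_exp_le_cylWeight (σ := s' * Real.log m) ht1 hx
      (by rw [← hdL]; gcongr) N
    refine ⟨n, hn, ?_⟩
    rw [hP, inv_natCast_pow_rpow hm0 n s' (hd0.trans hds'.le)]
    exact ENNReal.ofReal_le_ofReal hle
  · rcases eq_or_ne s 0 with rfl | hs0
    · simp
    have hs0' : (0 : ℝ) < s := by positivity
    have hsd : (s : ℝ) < d := by
      rw [← ENNReal.ofReal_coe_nnreal] at hs
      exact (ENNReal.ofReal_lt_ofReal_iff_of_nonneg s.2).1 hs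
    set E : ℕ → Set (ℕ → Fin m) := fun N => {x | (∀ k, A (x k) (x (2 * k + 1)) = 1) ∧
      ∀ n ≥ N, cylWeight (transProb A t) x n ≤ Real.exp (-(s * Real.log m) * n)} with hE
    have hae : ∀ᵐ x ∂P, x ∈ ⋃ N, E N := by
      filter_upwards [ae_forall_cylWeight_ne_zero hP,
        ae_forall_tendsto_average_digitDev hp0 (sum_transProb hm0 ht0 ht2) hP] with x hx hlim
      obtain ⟨N, hN⟩ := eventually_atTop.1 (eventually_cylWeight_le_exp hA01 ht0 hT
        (sum_abs_freqGap_isLittleO hp0 (sum_transProb hm0 ht0 ht2) hlim)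
        (σ := s * Real.log m) (by rw [← hdL]; gcongr))
      exact Set.mem_iUnion.2 ⟨N, apply_eq_one_of_cylWeight_ne_zero hA01 hx, hN⟩
    obtain ⟨N, hN⟩ : ∃ N, P (E N) ≠ 0 := by
      by_contra! h
      have h0 := measure_iUnion_null h
      exact (IsProbabilityMeasure.ne_zero P) (by
        rw [← Measure.measure_univ_eq_zero, ← Set.union_compl_self (⋃ N, E N)]
        exact measure_union_null h0 hae)
    have hpos : μH[s] (Real.ofDigits '' E N) ≠ 0 :=
      hausdorffMeasure_image_ofDigits_ne_zero hm P hs0' hN fun x hx n hn => by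
        rw [hP, inv_natCast_pow_rpow hm0 n s s.2]
        exact ENNReal.ofReal_le_ofReal (hx.2 n hn)
    exact (le_dimH_of_hausdorffMeasure_ne_zero hpos).trans
      (dimH_mono (Set.image_mono fun x hx => hx.1))
end
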